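/- arXiv:2110.05244 — 2 statements merged into one kernel-verified Lean document; each statement's English description precedes it below -/
import Mathlib

section
/- (Ulam–Hyers stability.) Let 0 < α < 1, b > 0, J = [0,b]. Let ψ : J → ℝ be increasing and continuously differentiable with ψ'(z) > 0 for all z ∈ J. Let F : J × ℝ × ℝ → ℝ and H : J × J × ℝ → ℝ be continuous satisfying (Q1) |F(z, u₁, u₂) − F(z, v₁, v₂)| ≤ n(z)(|u₁ − v₁| + |u₂ − v₂|) and (Q2) |H(z, τ, u) − H(z, τ, v)| ≤ k(z)|u − v| for continuous n, k : J → ℝ, and set W₁ = sup_{z ∈ J} |n(z)|, W₂ = sup_{z ∈ J} |k(z)|. Let ε > 0 and let ω : J → ℝ be continuously differentiable with |N^{α,ψ}ω(z) − F(z, ω(z), (1/Γ(α)) ∫₀^z ψ'(τ)(ψ(z) − ψ(τ))^{α−1} H(z, τ, N^{α,ψ}ω(τ)) dτ)| ≤ ε for all z ∈ J. If ϑ : J → ℝ is a continuously differentiable solution of N^{α,ψ}ϑ(z) = F(z, ϑ(z), (1/Γ(α)) ∫₀^z ψ'(τ)(ψ(z) − ψ(τ))^{α−1} H(z, τ, N^{α,ψ}ϑ(τ))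 dτ) for all z ∈ J with ϑ(0) = ω(0), then for γ = ((ψ(b) − ψ(0))^α / Γ(α + 1)) · E_α(W₁(1 + W₂)(ψ(b) − ψ(0))^α) one has |ω(z) − ϑ(z)| ≤ γ ε for all z ∈ J. -/
open MeasureTheory Set

/-- ψ-Riemann–Liouville fractional integral of order `α` of `f` with respect to `ψ`
(with `ψ'` a given derivative function of `ψ`):
`I^{α,ψ} f (z) = (1/Γ(α)) ∫₀^z ψ'(κ) (ψ(z) - ψ(κ))^(α-1) f(κ) dκ`. -/
noncomputable def psiInt (α : ℝ) (ψ ψ' f : ℝ → ℝ) (z : ℝ) : ℝ :=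
  (1 / Real.Gamma α) * ∫ κ in (0:ℝ)..z, ψ' κ * (ψ z - ψ κ) ^ (α - 1) * f κ

/-- ψ-Caputo fractional derivative of order `α` (for `0 < α < 1`) of a function with
derivative `v'`, with respect to `ψ` (with derivative `ψ'`):
`N^{α,ψ} v (z) = (1/Γ(1-α)) ∫₀^z ψ'(κ) (ψ(z) - ψ(κ))^(-α) (v'(κ)/ψ'(κ)) dκ`. -/
noncomputable def psiCaputo (α : ℝ) (ψ ψ' v' : ℝ → ℝ) (z : ℝ) : ℝ :=
  (1 / Real.Gamma (1 - α)) * ∫ κ in (0:ℝ)..z, ψ' κ * (ψ z - ψ κ) ^ (-α) * (v' κ / ψ' κ)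

/-- Mittag-Leffler function `E_α(x) = ∑_{m=0}^∞ x^m / Γ(α m + 1)`. -/
noncomputable def mittagLeffler (α x : ℝ) : ℝ :=
  ∑' m : ℕ, x ^ m / Real.Gamma (α * m + 1)

/-- The Riemann–Liouville fractional integral of order `a`, based at `0`. -/
noncomputable def riemannLiouville (a : ℝ) (g : ℝ → ℝ) (t : ℝ) : ℝ :=
  (1 / Real.Gamma a) * ∫ s in (0:ℝ)..t, (t - s) ^ (a - 1) * g s

section riemannLiouville

variable {a b t T : ℝ} {g h : ℝ → ℝ}

theorem intervalIntegrable_sub_rpow (ha : 0 < a) (t : ℝ) :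
    IntervalIntegrable (fun s : ℝ => (t - s) ^ (a - 1)) volume 0 t := by
  have := (intervalIntegral.intervalIntegrable_rpow' (r := a - 1) (a := t) (b := 0)
    (by linarith)).comp_sub_left t
  simpa using this

theorem intervalIntegrable_sub_rpow_mul (ha : 0 < a) (ht : 0 ≤ t)
    (hg : ContinuousOn g (Icc 0 t)) :
    IntervalIntegrable (fun s : ℝ => (t - s) ^ (a - 1) * g s) volume 0 t :=
  (intervalIntegrable_sub_rpow ha t).mul_continuousOn (by rwa [uIcc_of_le ht])

theorem riemannLiouville_congr (ht : 0 ≤ t) (hgh : ∀ s ∈ Icc 0 t, g s = h s) :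
    riemannLiouville a g t = riemannLiouville a h t := by
  unfold riemannLiouville
  congr 1
  refine intervalIntegral.integral_congr fun s hs => ?_
  rw [uIcc_of_le ht] at hs
  simp only [hgh s hs]

theorem riemannLiouville_mono (ha : 0 < a) (ht : 0 ≤ t) (hg : ContinuousOn g (Icc 0 t))
    (hh : ContinuousOn h (Icc 0 t)) (hgh : ∀ s ∈ Icc 0 t, g s ≤ h s) :
    riemannLiouville a g t ≤ riemannLiouville a h t := by
  have := Real.Gamma_pos_of_pos ha
  refine mul_le_mul_of_nonneg_left ?_ (by positivity)
  refine intervalIntegral.integral_mono_on ht (intervalIntegrable_sub_rpow_mul ha ht hg)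
    (intervalIntegrable_sub_rpow_mul ha ht hh) fun s hs => ?_
  exact mul_le_mul_of_nonneg_left (hgh s hs) (Real.rpow_nonneg (sub_nonneg.2 hs.2) _)

theorem riemannLiouville_add (ha : 0 < a) (ht : 0 ≤ t) (hg : ContinuousOn g (Icc 0 t))
    (hh : ContinuousOn h (Icc 0 t)) :
    riemannLiouville a (fun s => g s + h s) t = riemannLiouville a g t + riemannLiouville a h t := by
  simp only [riemannLiouville, mul_add]
  rw [intervalIntegral.integral_add (intervalIntegrable_sub_rpow_mul ha ht hg)
    (intervalIntegrable_sub_rpow_mul ha ht hh), mul_add]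

theorem riemannLiouville_const_mul (c : ℝ) :
    riemannLiouville a (fun s => c * g s) t = c * riemannLiouville a g t := by
  simp only [riemannLiouville, mul_left_comm _ c, intervalIntegral.integral_const_mul]

theorem riemannLiouville_neg :
    riemannLiouville a (fun s => -g s) t = -riemannLiouville a g t := by
  simpa using riemannLiouville_const_mul (a := a) (g := g) (t := t) (-1)

theorem riemannLiouville_sub (ha : 0 < a) (ht : 0 ≤ t) (hg : ContinuousOn g (Icc 0 t))
    (hh : ContinuousOn h (Icc 0 t)) :
    riemannLiouville a (fun s => g s - h s) t = riemannLiouville a g t - riemannLiouville a h t := by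
  simp only [sub_eq_add_neg]
  rw [riemannLiouville_add ha ht hg hh.fun_neg, riemannLiouville_neg]

theorem abs_riemannLiouville_le (ha : 0 < a) (ht : 0 ≤ t) (hg : ContinuousOn g (Icc 0 t))
    (hh : ContinuousOn h (Icc 0 t)) (hgh : ∀ s ∈ Icc 0 t, |g s| ≤ h s) :
    |riemannLiouville a g t| ≤ riemannLiouville a h t := by
  refine abs_le'.2 ⟨riemannLiouville_mono ha ht hg hh fun s hs => (abs_le'.1 (hgh s hs)).1, ?_⟩
  rw [← riemannLiouville_neg]
  exact riemannLiouville_mono ha ht hg.neg hh fun s hs => (abs_le'.1 (hgh s hs)).2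

theorem integral_rpow_mul_sub_rpow {p : ℝ} (hp : 0 < p) (ha : 0 < a) (ht : 0 < t) :
    ∫ s in (0:ℝ)..t, s ^ (p - 1) * (t - s) ^ (a - 1) =
      t ^ (p + a - 1) * (Real.Gamma p * Real.Gamma a / Real.Gamma (p + a)) := by
  have key := Complex.betaIntegral_scaled p a ht
  rw [Complex.betaIntegral_eq_Gamma_mul_div _ _ (by simpa) (by simpa), ← Complex.ofReal_add,
    Complex.Gamma_ofReal, Complex.Gamma_ofReal, Complex.Gamma_ofReal] at key
  have hcongr : ∫ x in (0:ℝ)..t, (x : ℂ) ^ ((p : ℂ) - 1) * ((t : ℂ) - x) ^ ((a : ℂ) - 1) =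
      ∫ x in (0:ℝ)..t, ((x ^ (p - 1) * (t - x) ^ (a - 1) : ℝ) : ℂ) := by
    refine intervalIntegral.integral_congr fun x hx => ?_
    rw [uIcc_of_le ht.le] at hx
    push_cast [Complex.ofReal_cpow hx.1, Complex.ofReal_cpow (sub_nonneg.2 hx.2)]
    rfl
  rw [hcongr, intervalIntegral.integral_ofReal] at key
  have hpow : (t : ℂ) ^ (((p + a : ℝ) : ℂ) - 1) = ((t ^ (p + a - 1) : ℝ) : ℂ) := by
    rw [Complex.ofReal_cpow ht.le]
    push_cast
    rfl
  rw [hpow] at key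
  exact_mod_cast key

theorem riemannLiouville_rpow {p : ℝ} (hp : 0 ≤ p) (ha : 0 < a) (ht : 0 ≤ t) :
    riemannLiouville a (fun s => s ^ p) t =
      Real.Gamma (p + 1) / Real.Gamma (a + p + 1) * t ^ (a + p) := by
  rcases ht.eq_or_lt with rfl | ht
  · simp [riemannLiouville, Real.zero_rpow (by positivity : a + p ≠ 0)]
  have h := integral_rpow_mul_sub_rpow (p := p + 1) (by positivity) ha ht
  have h' : ∫ s in (0:ℝ)..t, (t - s) ^ (a - 1) * s ^ p =
      ∫ s in (0:ℝ)..t, s ^ (p + 1 - 1) * (t - s) ^ (a - 1) := by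
    congr 1
    ext s
    rw [add_sub_cancel_right, mul_comm]
  rw [riemannLiouville, h', h]
  have := (Real.Gamma_pos_of_pos ha).ne'
  rw [show p + 1 + a - 1 = a + p by ring, show p + 1 + a = a + p + 1 by ring]
  field_simp

theorem riemannLiouville_const (c : ℝ) (ha : 0 < a) (ht : 0 ≤ t) :
    riemannLiouville a (fun _ => c) t = c * (t ^ a / Real.Gamma (a + 1)) := by
  have := riemannLiouville_rpow (p := 0) le_rfl ha ht
  simp only [Real.rpow_zero, zero_add, Real.Gamma_one, add_zero] at this
  have h := riemannLiouville_const_mul (a := a) (g := fun _ => 1) (t := t) c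
  simp only [mul_one] at h
  rw [h, this]
  ring

theorem abs_riemannLiouville_le_const {c : ℝ} (ha : 0 < a) (ht : 0 ≤ t)
    (hg : ContinuousOn g (Icc 0 t)) (hc : ∀ s ∈ Icc 0 t, |g s| ≤ c) :
    |riemannLiouville a g t| ≤ c * (t ^ a / Real.Gamma (a + 1)) :=
  riemannLiouville_const c ha ht ▸ abs_riemannLiouville_le ha ht hg continuousOn_const hc

theorem riemannLiouville_monomial (n : ℕ) (c : ℝ) (ha : 0 < a) (ht : 0 ≤ t) :
    riemannLiouville a (fun s => (Polynomial.monomial n c).eval s) t =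
      c * (Real.Gamma (n + 1) / Real.Gamma (a + n + 1)) * t ^ (a + n) := by
  simp only [Polynomial.eval_monomial]
  rw [riemannLiouville_const_mul, mul_assoc, ← riemannLiouville_rpow n.cast_nonneg ha ht]
  simp only [Real.rpow_natCast]

theorem continuousOn_riemannLiouville_polynomial (ha : 0 < a) (p : Polynomial ℝ) :
    ContinuousOn (riemannLiouville a fun s => p.eval s) (Ici 0) := by
  induction p using Polynomial.induction_on' with
  | add p q hp hq =>
    refine (hp.add hq).congr fun t ht => ?_
    simp only [Polynomial.eval_add]
    exact riemannLiouville_add ha ht p.continuous.continuousOn q.continuous.continuousOn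
  | monomial n c =>
    refine ContinuousOn.congr ?_ fun t ht => riemannLiouville_monomial n c ha ht
    exact continuousOn_const.mul
      (Real.continuous_rpow_const (by positivity)).continuousOn

theorem continuousOn_riemannLiouville (ha : 0 < a) (hg : ContinuousOn g (Icc 0 T)) :
    ContinuousOn (riemannLiouville a g) (Icc 0 T) := by
  rcases lt_or_ge T 0 with hT | hT
  · simp [Icc_eq_empty_of_lt hT]
  have hΓ := Real.Gamma_pos_of_pos (by positivity : 0 < a + 1)
  refine continuousOn_of_uniform_approx_of_continuousOn fun u hu => ?_
  obtain ⟨δ, hδ, hu⟩ := Metric.mem_uniformity_dist.1 hu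
  set C := T ^ a / Real.Gamma (a + 1)
  have hC : 0 ≤ C := by positivity
  obtain ⟨p, hp⟩ := exists_polynomial_near_of_continuousOn 0 T g hg (δ / (C + 1)) (by positivity)
  refine ⟨_, (continuousOn_riemannLiouville_polynomial ha p).mono Icc_subset_Ici_self,
    fun t ht => hu ?_⟩
  have hgt := hg.mono (Icc_subset_Icc_right ht.2)
  rw [Real.dist_eq, ← riemannLiouville_sub ha ht.1 hgt p.continuous.continuousOn]
  calc _ ≤ δ / (C + 1) * (t ^ a / Real.Gamma (a + 1)) :=
        abs_riemannLiouville_le_const ha ht.1 (hgt.fun_sub p.continuous.continuousOn) fun s hs => by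
          rw [abs_sub_comm]; exact (hp s ⟨hs.1, hs.2.trans ht.2⟩).le
    _ ≤ δ / (C + 1) * C := by
        simp only [C]
        gcongr
        · exact ht.1
        · exact ht.2
    _ < δ := by
        rw [div_mul_eq_mul_div, div_lt_iff₀ (by positivity)]
        nlinarith

theorem riemannLiouville_comp_polynomial (ha : 0 < a) (hb : 0 < b) (ht : 0 ≤ t)
    (p : Polynomial ℝ) :
    riemannLiouville a (riemannLiouville b fun s => p.eval s) t =
      riemannLiouville (a + b) (fun s => p.eval s) t := by
  have hcont (q : Polynomial ℝ) := (continuousOn_riemannLiouville_polynomial hb q).mono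
    (Icc_subset_Ici_self : Icc 0 t ⊆ Ici 0)
  induction p using Polynomial.induction_on' with
  | add p q hp hq =>
    simp only [Polynomial.eval_add]
    rw [riemannLiouville_add (by positivity) ht p.continuous.continuousOn
      q.continuous.continuousOn, ← hp, ← hq,
      ← riemannLiouville_add ha ht (hcont p) (hcont q)]
    exact riemannLiouville_congr ht fun s hs =>
      riemannLiouville_add hb hs.1 p.continuous.continuousOn q.continuous.continuousOn
  | monomial n c =>
    rw [riemannLiouville_congr ht fun s hs => riemannLiouville_monomial n c hb hs.1,
      riemannLiouville_const_mul, riemannLiouville_rpow (by positivity) ha ht,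
      riemannLiouville_monomial n c (by positivity) ht]
    have := (Real.Gamma_pos_of_pos (by positivity : 0 < b + n + 1)).ne'
    rw [show a + (b + n) = a + b + n by ring]
    field_simp

/-- The semigroup property of Riemann–Liouville integrals. -/
theorem riemannLiouville_comp (ha : 0 < a) (hb : 0 < b) (ht : 0 ≤ t)
    (hg : ContinuousOn g (Icc 0 t)) :
    riemannLiouville a (riemannLiouville b g) t = riemannLiouville (a + b) g t := by
  have hΓa := Real.Gamma_pos_of_pos (by positivity : 0 < a + 1)
  have hΓb := Real.Gamma_pos_of_pos (by positivity : 0 < b + 1)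
  have hΓab := Real.Gamma_pos_of_pos (by positivity : 0 < a + b + 1)
  set A := t ^ a / Real.Gamma (a + 1)
  set B := t ^ b / Real.Gamma (b + 1)
  set C := t ^ (a + b) / Real.Gamma (a + b + 1)
  have hA : 0 ≤ A := by positivity
  have hB : 0 ≤ B := by positivity
  have hC : 0 ≤ C := by positivity
  refine eq_of_forall_dist_le fun δ hδ => ?_
  obtain ⟨p, hp⟩ := exists_polynomial_near_of_continuousOn 0 t g hg (δ / (B * A + C + 1))
    (by positivity)
  set η := δ / (B * A + C + 1)
  have hη : 0 < η := by positivity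
  have hpc : ContinuousOn (fun s => p.eval s) (Icc 0 t) := p.continuous.continuousOn
  have hgp : ∀ s ∈ Icc 0 t, |g s - p.eval s| ≤ η := fun s hs => by
    rw [abs_sub_comm]; exact (hp s hs).le
  have h₁ : |riemannLiouville a (riemannLiouville b g) t -
      riemannLiouville a (riemannLiouville b fun s => p.eval s) t| ≤ η * B * A := by
    rw [← riemannLiouville_sub ha ht (continuousOn_riemannLiouville hb hg)
      (continuousOn_riemannLiouville hb hpc)]
    refine abs_riemannLiouville_le_const ha ht ((continuousOn_riemannLiouville hb hg).fun_sub
      (continuousOn_riemannLiouville hb hpc)) fun s hs => ?_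
    have hs' : Icc 0 s ⊆ Icc 0 t := Icc_subset_Icc_right hs.2
    rw [← riemannLiouville_sub hb hs.1 (hg.mono hs') (hpc.mono hs')]
    refine (abs_riemannLiouville_le_const hb hs.1 ((hg.fun_sub hpc).mono hs')
      fun r hr => hgp r (hs' hr)).trans ?_
    simp only [B]
    gcongr
    · exact hs.1
    · exact hs.2
  have h₂ : |riemannLiouville (a + b) g t - riemannLiouville (a + b) (fun s => p.eval s) t| ≤
      η * C := by
    rw [← riemannLiouville_sub (by positivity) ht hg hpc]
    exact abs_riemannLiouville_le_const (by positivity) ht (hg.fun_sub hpc) hgp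
  rw [riemannLiouville_comp_polynomial ha hb ht] at h₁
  have h₃ : η * (B * A + C + 1) = δ := div_mul_cancel₀ _ (by positivity)
  rw [Real.dist_eq]
  calc _ ≤ _ := abs_sub_le _ (riemannLiouville (a + b) (fun s => p.eval s) t) _
    _ ≤ η * B * A + η * C := add_le_add h₁ (by rwa [abs_sub_comm])
    _ ≤ δ := by nlinarith

end riemannLiouville

section Gamma

theorem Gamma_add_one_mul_le {a b : ℝ} (ha : 0 < a) (hb : 0 ≤ b) :
    Real.Gamma (a + 1) * Real.Gamma (b + 1) ≤ Real.Gamma (a + b + 1) := by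
  rcases hb.eq_or_lt with rfl | hb
  · simp
  have hΓ := Real.Gamma_pos_of_pos (by positivity : 0 < a + b + 1)
  have hΓa := Real.Gamma_pos_of_pos (by positivity : 0 < a + 1)
  have hΓb := Real.Gamma_pos_of_pos (by positivity : 0 < b + 1)
  have h {x y : ℝ} (hx : 0 < x) (hy : 0 < y) :
      Real.Gamma (x + 1) ≤ Real.Gamma (x + y + 1) ^ (x / (x + y)) := by
    have := Real.Gamma_mul_add_mul_le_rpow_Gamma_mul_rpow_Gamma (s := 1) (t := x + y + 1)
      (a := y / (x + y)) (b := x / (x + y)) one_pos (by positivity) (by positivity)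
      (by positivity) (by field_simp; ring)
    rwa [Real.Gamma_one, Real.one_rpow, one_mul,
      show y / (x + y) * 1 + x / (x + y) * (x + y + 1) = x + 1 by field_simp; ring] at this
  calc _ ≤ Real.Gamma (a + b + 1) ^ (a / (a + b)) * Real.Gamma (a + b + 1) ^ (b / (a + b)) := by
        refine mul_le_mul (h ha hb) ?_ hΓb.le (by positivity)
        simpa only [add_comm a b] using h hb ha
    _ = _ := by
        rw [← Real.rpow_add hΓ, ← add_div, div_self (by positivity), Real.rpow_one]

theorem rpow_mul_exp_neg_le_Gamma {A s : ℝ} (hA : 0 < A) (hs : 0 ≤ s) :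
    A ^ s * Real.exp (-A) ≤ Real.Gamma (s + 1) := by
  have hpsi : IntegrableOn (fun x : ℝ => Real.exp (-x) * x ^ s) (Ioi 0) := by
    simpa using Real.GammaIntegral_convergent (s := s + 1) (by positivity)
  rw [Real.Gamma_eq_integral (by positivity), add_sub_cancel_right]
  calc A ^ s * Real.exp (-A) = ∫ x in Ioi A, Real.exp (-x) * A ^ s := by
        rw [integral_mul_const, integral_exp_neg_Ioi, mul_comm]
    _ ≤ ∫ x in Ioi A, Real.exp (-x) * x ^ s := by
        refine setIntegral_mono_on ((integrableOn_exp_neg_Ioi A).mul_const _)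
          (hpsi.mono_set (Ioi_subset_Ioi hA.le)) measurableSet_Ioi fun x hx => ?_
        gcongr
        exact le_of_lt hx
    _ ≤ _ := by
        refine setIntegral_mono_set hpsi ?_ (Ioi_subset_Ioi hA.le).eventuallyLE
        filter_upwards [self_mem_ae_restrict measurableSet_Ioi] with x hx
        have : 0 < x := hx
        positivity

theorem summable_mittagLeffler {a x : ℝ} (ha : 0 < a) (hx : 0 ≤ x) :
    Summable fun m : ℕ => x ^ m / Real.Gamma (a * m + 1) := by
  set A := (x + 1) ^ (1 / a)
  have hA : 0 < A := by positivity
  have hAa : A ^ a = x + 1 := by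
    rw [← Real.rpow_mul (by positivity), one_div_mul_cancel ha.ne', Real.rpow_one]
  refine Summable.of_nonneg_of_le (fun m => ?_) (fun m => ?_)
    ((summable_geometric_of_lt_one (r := x / (x + 1)) (by positivity)
      ((div_lt_one (by positivity)).2 (by linarith))).mul_left (Real.exp A))
  · have := Real.Gamma_pos_of_pos (by positivity : 0 < a * m + 1)
    positivity
  · have h := rpow_mul_exp_neg_le_Gamma hA (by positivity : 0 ≤ a * m)
    rw [Real.rpow_mul hA.le, hAa, Real.rpow_natCast] at h
    calc _ ≤ x ^ m / ((x + 1) ^ m * Real.exp (-A)) := by gcongr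
      _ = _ := by
        rw [Real.exp_neg, div_pow]
        field_simp

end Gamma

section Gronwall

theorem riemannLiouville_sum {ι : Type*} (S : Finset ι) {a t : ℝ} {g : ι → ℝ → ℝ} (ha : 0 < a)
    (ht : 0 ≤ t) (hg : ∀ i ∈ S, ContinuousOn (g i) (Icc 0 t)) :
    riemannLiouville a (fun s => ∑ i ∈ S, g i s) t = ∑ i ∈ S, riemannLiouville a (g i) t := by
  induction S using Finset.cons_induction with
  | empty => simp [riemannLiouville]
  | cons i S hi ih =>
    simp only [Finset.sum_cons, Finset.forall_mem_cons] at hg ⊢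
    rw [riemannLiouville_add ha ht hg.1 (continuousOn_finsetSum S hg.2), ih hg.2]

/-- The Riemann–Liouville integral of a function satisfying a fractional integral inequality is
bounded in terms of the Mittag-Leffler function. -/
theorem riemannLiouville_le_mittagLeffler {a c ε T : ℝ} {u : ℝ → ℝ} (ha : 0 < a) (hc : 0 ≤ c)
    (hε : 0 ≤ ε) (hu : ContinuousOn u (Icc 0 T))
    (hle : ∀ t ∈ Icc 0 T, u t ≤ ε + c * riemannLiouville a u t) {t : ℝ} (ht : t ∈ Icc 0 T) :
    riemannLiouville a u t ≤
      T ^ a / Real.Gamma (a + 1) * mittagLeffler a (c * T ^ a) * ε := by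
  have hT : 0 ≤ T := ht.1.trans ht.2
  have hΓ (m : ℕ) : 0 < Real.Gamma (a * m + 1) := Real.Gamma_pos_of_pos (by positivity)
  have hΓa := Real.Gamma_pos_of_pos (by positivity : 0 < a + 1)
  obtain ⟨M, hM⟩ := isCompact_Icc.exists_bound_of_continuousOn hu
  have hM0 : 0 ≤ M := (norm_nonneg _).trans (hM t ht)
  set e : ℕ → ℝ → ℝ := fun m s => c ^ m * (1 / Real.Gamma (a * m + 1) * s ^ (a * m))
  have he (m : ℕ) (S : Set ℝ) : ContinuousOn (e m) S :=
    (((Real.continuous_rpow_const (by positivity)).const_mul _).const_mul _).continuousOn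
  have hRe (m : ℕ) {s : ℝ} (hs : 0 ≤ s) : riemannLiouville a (e m) s =
      c ^ m * (1 / Real.Gamma (a * (m + 1 : ℕ) + 1) * s ^ (a * (m + 1 : ℕ))) := by
    simp only [e]
    rw [riemannLiouville_const_mul, riemannLiouville_const_mul,
      riemannLiouville_rpow (by positivity) ha hs,
      show a + a * (m : ℝ) = a * (m + 1 : ℕ) by push_cast; ring]
    have := (hΓ m).ne'
    field_simp
  set B : ℕ → ℝ → ℝ := fun N s => ε * ∑ m ∈ Finset.range N, e m s + M * e N s
  have hB (N : ℕ) (S : Set ℝ) : ContinuousOn (B N) S :=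
    (continuousOn_const.mul (continuousOn_finsetSum _ fun m _ => he m S)).add
      (continuousOn_const.mul (he N S))
  have hRB (N : ℕ) {s : ℝ} (hs : 0 ≤ s) : riemannLiouville a (B N) s =
      ε * ∑ m ∈ Finset.range N, riemannLiouville a (e m) s +
        M * riemannLiouville a (e N) s := by
    simp only [B]
    rw [riemannLiouville_add ha hs
      (continuousOn_const.fun_mul (continuousOn_finsetSum _ fun m _ => he m _))
      (continuousOn_const.fun_mul (he N _)), riemannLiouville_const_mul, riemannLiouville_const_mul,
      riemannLiouville_sum _ ha hs fun m _ => he m _]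
  have hRuB {N : ℕ} (h : ∀ s ∈ Icc 0 T, u s ≤ B N s) {s : ℝ} (hs : s ∈ Icc 0 T) :
      riemannLiouville a u s ≤ riemannLiouville a (B N) s :=
    have hsub := Icc_subset_Icc_right hs.2
    riemannLiouville_mono ha hs.1 (hu.mono hsub) (hB N _) fun r hr => h r (hsub hr)
  have huB (N : ℕ) : ∀ s ∈ Icc 0 T, u s ≤ B N s := by
    induction N with
    | zero =>
      intro s hs
      simpa [B, e] using (le_abs_self _).trans (hM s hs)
    | succ N ih =>
      intro s hs
      have hce (m : ℕ) : e (m + 1) s = c * riemannLiouville a (e m) s := by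
        rw [hRe m hs.1, ← mul_assoc, ← pow_succ']
      calc u s ≤ ε + c * riemannLiouville a (B N) s :=
            (hle s hs).trans (by gcongr; exact hRuB ih hs)
        _ = B (N + 1) s := by
            have h0 : e 0 s = 1 := by simp [e]
            simp only [B]
            rw [hRB N hs.1, Finset.sum_range_succ', h0]
            simp only [hce, ← Finset.mul_sum]
            ring
  set x := c * T ^ a
  have hx : 0 ≤ x := by positivity
  have hRe_le (m : ℕ) : riemannLiouville a (e m) t ≤
      T ^ a / Real.Gamma (a + 1) * (x ^ m / Real.Gamma (a * m + 1)) := by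
    have hmul := Gamma_add_one_mul_le ha (by positivity : 0 ≤ a * m)
    have hcast : a * ((m + 1 : ℕ) : ℝ) = a + a * m := by push_cast; ring
    rw [hRe m ht.1, hcast]
    calc _ ≤ c ^ m * (1 / (Real.Gamma (a + 1) * Real.Gamma (a * m + 1)) * T ^ (a + a * m)) := by
          have := hΓ m
          obtain ⟨ht0, htT⟩ := ht
          gcongr
      _ = _ := by
          rw [Real.rpow_add_of_nonneg hT ha.le (by positivity), Real.rpow_mul hT,
            Real.rpow_natCast, mul_pow]
          field_simp
  have hsum := summable_mittagLeffler ha hx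
  have hlim := ((hsum.hasSum.tendsto_sum_nat.const_mul ε).add
    (hsum.tendsto_atTop_zero.const_mul M)).const_mul (T ^ a / Real.Gamma (a + 1))
  have hfin := ge_of_tendsto' hlim fun N => ((hRuB (huB N) ht).trans_eq (hRB N ht.1)).trans <| by
    calc _ ≤ ε * ∑ m ∈ Finset.range N,
            T ^ a / Real.Gamma (a + 1) * (x ^ m / Real.Gamma (a * m + 1)) +
          M * (T ^ a / Real.Gamma (a + 1) * (x ^ N / Real.Gamma (a * N + 1))) := by
          gcongr with m _
          · exact hRe_le m
          · exact hRe_le N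
      _ = T ^ a / Real.Gamma (a + 1) * (ε * ∑ m ∈ Finset.range N,
          x ^ m / Real.Gamma (a * m + 1) + M * (x ^ N / Real.Gamma (a * N + 1))) := by
          rw [← Finset.mul_sum]
          ring
  refine hfin.trans_eq ?_
  rw [mittagLeffler]
  ring

end Gronwall

section ChangeOfVariables

/-- `φ` is a continuous map into `[0, b]` inverting `z ↦ ψ z - ψ 0` on `[0, b]`. -/
structure IsShiftedInverse (b : ℝ) (ψ φ : ℝ → ℝ) : Prop where
  continuous : Continuous φ
  mem_Icc : ∀ t, φ t ∈ Icc 0 b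
  left_inv : ∀ z ∈ Icc 0 b, φ (ψ z - ψ 0) = z
  right_inv : ∀ t ∈ Icc 0 (ψ b - ψ 0), ψ (φ t) - ψ 0 = t

theorem MonotoneOn.sub_mem_Icc {b z : ℝ} {ψ : ℝ → ℝ} (hψ : MonotoneOn ψ (Icc 0 b))
    (hz : z ∈ Icc 0 b) : ψ z - ψ 0 ∈ Icc 0 (ψ b - ψ 0) :=
  have hb := hz.1.trans hz.2
  ⟨sub_nonneg.2 (hψ (left_mem_Icc.2 hb) hz hz.1),
    sub_le_sub_right (hψ hz (right_mem_Icc.2 hb) hz.2) _⟩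

theorem MonotoneOn.image_sub_Icc {b : ℝ} {ψ : ℝ → ℝ} (hψ : MonotoneOn ψ (Icc 0 b))
    (hψc : ContinuousOn ψ (Icc 0 b)) (hb : 0 ≤ b) :
    (fun z => ψ z - ψ 0) '' Icc 0 b = Icc 0 (ψ b - ψ 0) := by
  refine Subset.antisymm (image_subset_iff.2 fun z hz => hψ.sub_mem_Icc hz) ?_
  simpa using intermediate_value_Icc hb (hψc.sub (continuousOn_const (c := ψ 0)))

theorem exists_isShiftedInverse {b : ℝ} {ψ : ℝ → ℝ} (hψ : StrictMonoOn ψ (Icc 0 b))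
    (hψc : ContinuousOn ψ (Icc 0 b)) (hb : 0 ≤ b) : ∃ φ, IsShiftedInverse b ψ φ := by
  have hmem := fun z (hz : z ∈ Icc 0 b) => hψ.monotoneOn.sub_mem_Icc hz
  have hT : 0 ≤ ψ b - ψ 0 := (hmem b (right_mem_Icc.2 hb)).1
  let f : Icc 0 b → Icc 0 (ψ b - ψ 0) := fun z => ⟨ψ z - ψ 0, hmem z z.2⟩
  have hf : Function.Bijective f := by
    refine ⟨fun x y hxy => Subtype.ext (hψ.injOn x.2 y.2 ?_), fun t => ?_⟩
    · simpa [f] using hxy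
    · obtain ⟨z, hz, hzt⟩ := (hψ.monotoneOn.image_sub_Icc hψc hb).superset t.2
      exact ⟨⟨z, hz⟩, Subtype.ext hzt⟩
  have hfc : Continuous f :=
    Continuous.subtype_mk (hψc.domRestrict.sub continuous_const) _
  let e := Equiv.ofBijective f hf
  have he : Continuous e.symm := Continuous.continuous_symm_of_equiv_compact_to_t2 (f := e) hfc
  refine ⟨fun t => e.symm (projIcc 0 _ hT t),
    continuous_subtype_val.comp (he.comp continuous_projIcc), fun t => Subtype.coe_prop _,
    fun z hz => ?_, fun t ht => ?_⟩
  · rw [projIcc_of_mem hT (hmem z hz)]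
    exact congrArg Subtype.val (e.symm_apply_apply ⟨z, hz⟩)
  · rw [projIcc_of_mem hT ht]
    exact congrArg Subtype.val (e.apply_symm_apply ⟨t, ht⟩)

theorem le_sSup_image_abs {b z : ℝ} {f : ℝ → ℝ} (hf : ContinuousOn f (Icc 0 b))
    (hz : z ∈ Icc 0 b) : f z ≤ sSup ((fun z => |f z|) '' Icc 0 b) :=
  (le_abs_self _).trans
    (le_csSup (isCompact_Icc.image_of_continuousOn hf.abs).bddAbove (mem_image_of_mem _ hz))

theorem psiCaputo_eq_psiInt (α : ℝ) (ψ ψ' v' : ℝ → ℝ) :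
    psiCaputo α ψ ψ' v' = psiInt (1 - α) ψ ψ' fun z => v' z / ψ' z := by
  ext z
  simp only [psiCaputo, psiInt, sub_sub_cancel_left]

theorem psiInt_one_div {b z : ℝ} {ψ ψ' u u' : ℝ → ℝ} (hψ'_pos : ∀ z ∈ Icc 0 b, 0 < ψ' z)
    (hu : ∀ z ∈ Icc 0 b, HasDerivWithinAt u (u' z) (Icc 0 b) z)
    (hu' : ContinuousOn u' (Icc 0 b)) (hz : z ∈ Icc 0 b) :
    psiInt 1 ψ ψ' (fun z => u' z / ψ' z) z = u z - u 0 := by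
  have hsub : Icc 0 z ⊆ Icc 0 b := Icc_subset_Icc_right hz.2
  have hcongr : ∫ κ in (0:ℝ)..z, ψ' κ * (ψ z - ψ κ) ^ ((1:ℝ) - 1) * (u' κ / ψ' κ) =
      ∫ κ in (0:ℝ)..z, u' κ := by
    refine intervalIntegral.integral_congr fun κ hκ => ?_
    rw [uIcc_of_le hz.1] at hκ
    have := (hψ'_pos κ (hsub hκ)).ne'
    simp only [sub_self, Real.rpow_zero]
    field_simp
  rw [psiInt, Real.Gamma_one, div_one, one_mul, hcongr]
  refine intervalIntegral.integral_eq_sub_of_hasDerivAt_of_le hz.1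
    (fun x hx => ((hu x (hsub hx)).mono hsub).continuousWithinAt) (fun x hx => ?_)
    ((hu'.mono hsub).intervalIntegrable_of_Icc hz.1)
  exact (hu x (hsub (Ioo_subset_Icc_self hx))).hasDerivAt
    (Icc_mem_nhds hx.1 (hx.2.trans_le hz.2))

namespace IsShiftedInverse

variable {α b z : ℝ} {ψ φ ψ' u u' : ℝ → ℝ}

theorem psiInt_eq {a : ℝ} {f : ℝ → ℝ} (hφ : IsShiftedInverse b ψ φ)
    (hψ_mono : StrictMonoOn ψ (Icc 0 b))
    (hψ_deriv : ∀ z ∈ Icc 0 b, HasDerivWithinAt ψ (ψ' z) (Icc 0 b) z)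
    (hψ'_pos : ∀ z ∈ Icc 0 b, 0 < ψ' z) (hz : z ∈ Icc 0 b) :
    psiInt a ψ ψ' f z = riemannLiouville a (fun s => f (φ s)) (ψ z - ψ 0) := by
  have hsub : Icc 0 z ⊆ Icc 0 b := Icc_subset_Icc_right hz.2
  have hderiv : ∀ x ∈ Icc 0 z, HasDerivWithinAt (fun x => ψ x - ψ 0) (ψ' x) (Icc 0 z) x :=
    fun x hx => ((hψ_deriv x (hsub hx)).mono hsub).sub_const _
  have hψz := hψ_mono.mono hsub
  have hcov := integral_image_eq_integral_abs_deriv_smul measurableSet_Icc hderiv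
    (fun x hx y hy hxy => hψz.injOn hx hy (by simpa using hxy))
    fun s => (ψ z - ψ 0 - s) ^ (a - 1) * f (φ s)
  rw [hψz.monotoneOn.image_sub_Icc
    (fun x hx => ((hψ_deriv x (hsub hx)).mono hsub).continuousWithinAt) hz.1] at hcov
  rw [psiInt, riemannLiouville, intervalIntegral.integral_of_le hz.1,
    intervalIntegral.integral_of_le (hψ_mono.monotoneOn.sub_mem_Icc hz).1,
    ← integral_Icc_eq_integral_Ioc, ← integral_Icc_eq_integral_Ioc, hcov]
  congr 1
  refine setIntegral_congr_fun measurableSet_Icc fun x hx => ?_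
  simp only [smul_eq_mul, sub_sub_sub_cancel_right, hφ.left_inv x (hsub hx),
    abs_of_pos (hψ'_pos x (hsub hx)), mul_assoc]

theorem psiCaputo_comp_eq (hφ : IsShiftedInverse b ψ φ) (hψ_mono : StrictMonoOn ψ (Icc 0 b))
    (hψ_deriv : ∀ z ∈ Icc 0 b, HasDerivWithinAt ψ (ψ' z) (Icc 0 b) z)
    (hψ'_pos : ∀ z ∈ Icc 0 b, 0 < ψ' z) {t : ℝ} (ht : t ∈ Icc 0 (ψ b - ψ 0)) :
    psiCaputo α ψ ψ' u' (φ t) = riemannLiouville (1 - α) (fun s => u' (φ s) / ψ' (φ s)) t := by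
  rw [psiCaputo_eq_psiInt, hφ.psiInt_eq hψ_mono hψ_deriv hψ'_pos (hφ.mem_Icc t),
    hφ.right_inv t ht]

theorem continuous_div_comp (hφ : IsShiftedInverse b ψ φ) (hψ'_cont : ContinuousOn ψ' (Icc 0 b))
    (hψ'_pos : ∀ z ∈ Icc 0 b, 0 < ψ' z) (hu' : ContinuousOn u' (Icc 0 b)) :
    Continuous fun s => u' (φ s) / ψ' (φ s) :=
  (hu'.div hψ'_cont fun z hz => (hψ'_pos z hz).ne').comp_continuous hφ.continuous hφ.mem_Icc

theorem continuousOn_psiCaputo_comp (hφ : IsShiftedInverse b ψ φ) (hα1 : α < 1)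
    (hψ_mono : StrictMonoOn ψ (Icc 0 b))
    (hψ_deriv : ∀ z ∈ Icc 0 b, HasDerivWithinAt ψ (ψ' z) (Icc 0 b) z)
    (hψ'_cont : ContinuousOn ψ' (Icc 0 b)) (hψ'_pos : ∀ z ∈ Icc 0 b, 0 < ψ' z)
    (hu' : ContinuousOn u' (Icc 0 b)) :
    ContinuousOn (fun s => psiCaputo α ψ ψ' u' (φ s)) (Icc 0 (ψ b - ψ 0)) :=
  (continuousOn_riemannLiouville (sub_pos.2 hα1)
    (hφ.continuous_div_comp hψ'_cont hψ'_pos hu').continuousOn).congr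
    fun _ ht => hφ.psiCaputo_comp_eq hψ_mono hψ_deriv hψ'_pos ht

theorem riemannLiouville_psiCaputo_comp (hφ : IsShiftedInverse b ψ φ) (hα0 : 0 < α) (hα1 : α < 1)
    (hψ_mono : StrictMonoOn ψ (Icc 0 b))
    (hψ_deriv : ∀ z ∈ Icc 0 b, HasDerivWithinAt ψ (ψ' z) (Icc 0 b) z)
    (hψ'_cont : ContinuousOn ψ' (Icc 0 b)) (hψ'_pos : ∀ z ∈ Icc 0 b, 0 < ψ' z)
    (hu : ∀ z ∈ Icc 0 b, HasDerivWithinAt u (u' z) (Icc 0 b) z)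
    (hu' : ContinuousOn u' (Icc 0 b)) (hz : z ∈ Icc 0 b) :
    riemannLiouville α (fun s => psiCaputo α ψ ψ' u' (φ s)) (ψ z - ψ 0) = u z - u 0 := by
  have ht := hψ_mono.monotoneOn.sub_mem_Icc hz
  rw [riemannLiouville_congr ht.1 fun s hs => hφ.psiCaputo_comp_eq hψ_mono hψ_deriv hψ'_pos
      ⟨hs.1, hs.2.trans ht.2⟩,
    riemannLiouville_comp hα0 (sub_pos.2 hα1) ht.1
      (hφ.continuous_div_comp hψ'_cont hψ'_pos hu').continuousOn, add_sub_cancel,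
    ← psiInt_one_div hψ'_pos hu hu' hz, hφ.psiInt_eq hψ_mono hψ_deriv hψ'_pos hz]

end IsShiftedInverse

end ChangeOfVariables

/-- Ulam–Hyers stability: if `ω` satisfies the problem up to error `ε` and `ϑ` is a
solution with the same initial value, then `|ω(z) - ϑ(z)| ≤ γ ε` with
`γ = ((ψ(b)-ψ(0))^α / Γ(α+1)) · E_α(W₁(1+W₂)(ψ(b)-ψ(0))^α)`. -/
theorem caputo_ulam_hyers_stability (α b : ℝ) (hα0 : 0 < α) (hα1 : α < 1) (hb : 0 < b)
    (ψ ψ' : ℝ → ℝ)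
    (hψ_mono : StrictMonoOn ψ (Set.Icc 0 b))
    (hψ_deriv : ∀ z ∈ Set.Icc 0 b, HasDerivWithinAt ψ (ψ' z) (Set.Icc 0 b) z)
    (hψ'_cont : ContinuousOn ψ' (Set.Icc 0 b))
    (hψ'_pos : ∀ z ∈ Set.Icc 0 b, 0 < ψ' z)
    (F : ℝ → ℝ → ℝ → ℝ) (H : ℝ → ℝ → ℝ → ℝ)
    (hF_cont : ContinuousOn (fun p : ℝ × ℝ × ℝ => F p.1 p.2.1 p.2.2)
      (Set.Icc 0 b ×ˢ (Set.univ : Set ℝ) ×ˢ (Set.univ : Set ℝ)))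
    (hH_cont : ContinuousOn (fun p : ℝ × ℝ × ℝ => H p.1 p.2.1 p.2.2)
      (Set.Icc 0 b ×ˢ Set.Icc 0 b ×ˢ (Set.univ : Set ℝ)))
    (n k : ℝ → ℝ)
    (hn_cont : ContinuousOn n (Set.Icc 0 b))
    (hk_cont : ContinuousOn k (Set.Icc 0 b))
    (hQ1 : ∀ z ∈ Set.Icc 0 b, ∀ u₁ u₂ w₁ w₂ : ℝ,
      |F z u₁ u₂ - F z w₁ w₂| ≤ n z * (|u₁ - w₁| + |u₂ - w₂|))
    (hQ2 : ∀ z ∈ Set.Icc 0 b, ∀ τ ∈ Set.Icc 0 b, ∀ u w : ℝ,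
      |H z τ u - H z τ w| ≤ k z * |u - w|)
    (W₁ W₂ : ℝ)
    (hW₁ : W₁ = sSup ((fun z => |n z|) '' Set.Icc 0 b))
    (hW₂ : W₂ = sSup ((fun z => |k z|) '' Set.Icc 0 b))
    (ε : ℝ) (hε : 0 < ε)
    (ω ω' : ℝ → ℝ)
    (hω_deriv : ∀ z ∈ Set.Icc 0 b, HasDerivWithinAt ω (ω' z) (Set.Icc 0 b) z)
    (hω'_cont : ContinuousOn ω' (Set.Icc 0 b))
    (hω_approx : ∀ z ∈ Set.Icc 0 b,
      |psiCaputo α ψ ψ' ω' z -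
        F z (ω z) (psiInt α ψ ψ' (fun τ => H z τ (psiCaputo α ψ ψ' ω' τ)) z)| ≤ ε)
    (v v' : ℝ → ℝ)
    (hv_deriv : ∀ z ∈ Set.Icc 0 b, HasDerivWithinAt v (v' z) (Set.Icc 0 b) z)
    (hv'_cont : ContinuousOn v' (Set.Icc 0 b))
    (hv_sol : ∀ z ∈ Set.Icc 0 b,
      psiCaputo α ψ ψ' v' z =
        F z (v z) (psiInt α ψ ψ' (fun τ => H z τ (psiCaputo α ψ ψ' v' τ)) z))
    (hv0 : v 0 = ω 0) :
    ∀ z ∈ Set.Icc 0 b,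
      |ω z - v z| ≤
        (ψ b - ψ 0) ^ α / Real.Gamma (α + 1) *
          mittagLeffler α (W₁ * (1 + W₂) * (ψ b - ψ 0) ^ α) * ε := by
  have hW₁_le : ∀ z ∈ Icc 0 b, n z ≤ W₁ := fun z hz => hW₁ ▸ le_sSup_image_abs hn_cont hz
  have hW₂_le : ∀ z ∈ Icc 0 b, k z ≤ W₂ := fun z hz => hW₂ ▸ le_sSup_image_abs hk_cont hz
  have h0b : (0:ℝ) ∈ Icc 0 b := left_mem_Icc.2 hb.le
  have hn_nonneg : ∀ z ∈ Icc 0 b, 0 ≤ n z := fun z hz => by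
    simpa using (abs_nonneg _).trans (hQ1 z hz 1 0 0 0)
  have hk_nonneg : ∀ z ∈ Icc 0 b, 0 ≤ k z := fun z hz => by
    simpa using (abs_nonneg _).trans (hQ2 z hz z hz 1 0)
  have hW₁_nonneg : 0 ≤ W₁ := (hn_nonneg 0 h0b).trans (hW₁_le 0 h0b)
  have hW₂_nonneg : 0 ≤ W₂ := (hk_nonneg 0 h0b).trans (hW₂_le 0 h0b)
  obtain ⟨φ, hφ⟩ := exists_isShiftedInverse hψ_mono
    (fun z hz => (hψ_deriv z hz).continuousWithinAt) hb.le
  have hNω := hφ.continuousOn_psiCaputo_comp hα1 hψ_mono hψ_deriv hψ'_cont hψ'_pos hω'_cont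
  have hNv := hφ.continuousOn_psiCaputo_comp hα1 hψ_mono hψ_deriv hψ'_cont hψ'_pos hv'_cont
  set D : ℝ → ℝ := fun s => psiCaputo α ψ ψ' ω' (φ s) - psiCaputo α ψ ψ' v' (φ s) with hD_def
  have hD : ContinuousOn D (Icc 0 (ψ b - ψ 0)) := hNω.sub hNv
  have hmem : ∀ z ∈ Icc 0 b, ψ z - ψ 0 ∈ Icc 0 (ψ b - ψ 0) := fun z hz =>
    hψ_mono.monotoneOn.sub_mem_Icc hz
  have hdiff : ∀ z ∈ Icc 0 b, |ω z - v z| ≤ riemannLiouville α (fun s => |D s|) (ψ z - ψ 0) := by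
    intro z hz
    have hsub : Icc 0 (ψ z - ψ 0) ⊆ Icc 0 (ψ b - ψ 0) := Icc_subset_Icc_right (hmem z hz).2
    have h₁ := hφ.riemannLiouville_psiCaputo_comp hα0 hα1 hψ_mono hψ_deriv hψ'_cont hψ'_pos
      hω_deriv hω'_cont hz
    have h₂ := hφ.riemannLiouville_psiCaputo_comp hα0 hα1 hψ_mono hψ_deriv hψ'_cont hψ'_pos
      hv_deriv hv'_cont hz
    have h : ω z - v z = riemannLiouville α D (ψ z - ψ 0) := by
      rw [hD_def, riemannLiouville_sub hα0 (hmem z hz).1 (hNω.mono hsub) (hNv.mono hsub), h₁, h₂,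
        hv0]
      ring
    rw [h]
    exact abs_riemannLiouville_le hα0 (hmem z hz).1 (hD.mono hsub) (hD.mono hsub).abs
      fun _ _ => le_rfl
  have hpsi : ∀ z ∈ Icc 0 b,
      |psiInt α ψ ψ' (fun τ => H z τ (psiCaputo α ψ ψ' ω' τ)) z -
        psiInt α ψ ψ' (fun τ => H z τ (psiCaputo α ψ ψ' v' τ)) z| ≤
      k z * riemannLiouville α (fun s => |D s|) (ψ z - ψ 0) := by
    intro z hz
    have hsub : Icc 0 (ψ z - ψ 0) ⊆ Icc 0 (ψ b - ψ 0) := Icc_subset_Icc_right (hmem z hz).2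
    have hHc {N : ℝ → ℝ} (hN : ContinuousOn N (Icc 0 (ψ b - ψ 0))) :
        ContinuousOn (fun s => H z (φ s) (N s)) (Icc 0 (ψ z - ψ 0)) :=
      hH_cont.comp (continuousOn_const.prodMk
        (hφ.continuous.continuousOn.prodMk (hN.mono hsub)))
        fun s _ => ⟨hz, hφ.mem_Icc s, mem_univ _⟩
    rw [hφ.psiInt_eq hψ_mono hψ_deriv hψ'_pos hz, hφ.psiInt_eq hψ_mono hψ_deriv hψ'_pos hz,
      ← riemannLiouville_sub hα0 (hmem z hz).1 (hHc hNω) (hHc hNv),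
      ← riemannLiouville_const_mul]
    exact abs_riemannLiouville_le hα0 (hmem z hz).1 ((hHc hNω).sub (hHc hNv))
      (continuousOn_const.mul (hD.mono hsub).abs) fun s _ => hQ2 z hz _ (hφ.mem_Icc s) _ _
  have hineq : ∀ t ∈ Icc 0 (ψ b - ψ 0),
      |D t| ≤ ε + W₁ * (1 + W₂) * riemannLiouville α (fun s => |D s|) t := by
    intro t ht
    have hz := hφ.mem_Icc t
    have hd := hdiff _ hz
    have hi := hpsi _ hz
    rw [hφ.right_inv t ht] at hd hi
    set R := riemannLiouville α (fun s => |D s|) t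
    have hR : 0 ≤ R := (abs_nonneg _).trans hd
    have hQ := hQ1 (φ t) hz (ω (φ t))
      (psiInt α ψ ψ' (fun τ => H (φ t) τ (psiCaputo α ψ ψ' ω' τ)) (φ t)) (v (φ t))
      (psiInt α ψ ψ' (fun τ => H (φ t) τ (psiCaputo α ψ ψ' v' τ)) (φ t))
    rw [← hv_sol _ hz] at hQ
    calc |D t| ≤ _ := abs_sub_le _ (F (φ t) (ω (φ t))
          (psiInt α ψ ψ' (fun τ => H (φ t) τ (psiCaputo α ψ ψ' ω' τ)) (φ t))) _
      _ ≤ ε + n (φ t) * (R + k (φ t) * R) :=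
        add_le_add (hω_approx _ hz) (hQ.trans
          (mul_le_mul_of_nonneg_left (add_le_add hd hi) (hn_nonneg _ hz)))
      _ ≤ ε + W₁ * (R + W₂ * R) := by
        have := hk_nonneg _ hz
        gcongr
        · exact hW₁_le _ hz
        · exact hW₂_le _ hz
      _ = _ := by ring
  intro z hz
  exact (hdiff z hz).trans
    (riemannLiouville_le_mittagLeffler hα0 (by positivity) hε.le hD.abs hineq (hmem z hz))
end

section
/- (Ulam–Hyers–Rassias stability.) Let 0 < α < 1, b > 0, J = [0,b]. Let ψ : J → ℝ be increasing and continuously differentiable with ψ'(z) > 0 for all z ∈ J. Let F : J × ℝ × ℝ → ℝ and H : J × J × ℝ → ℝ be continuous satisfying (Q1) |F(z, u₁, u₂) − F(z, v₁, v₂)| ≤ n(z)(|u₁ − v₁| + |u₂ − v₂|) and (Q2) |H(z, τ, u) − H(z, τ, v)| ≤ k(z)|u − v| for continuous n, k : J → ℝ, and set W₁ = sup_{z ∈ J} |n(z)|, W₂ = sup_{z ∈ J} |k(z)|. Suppose ρ : J → ℝ is a continuous increasing nonnegative function and γ > 0 satisfy (Q3) (1/Γ(α)) ∫₀^z ψ'(κ)(ψ(z)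 − ψ(κ))^{α−1} ρ(κ) dκ ≤ γ ρ(z) for all z ∈ J, and that W₁(1 + W₂)γ < 1. Let ε > 0 and let ω : J → ℝ be continuously differentiable with |N^{α,ψ}ω(z) − F(z, ω(z), (1/Γ(α)) ∫₀^z ψ'(τ)(ψ(z) − ψ(τ))^{α−1} H(z, τ, N^{α,ψ}ω(τ)) dτ)| ≤ ε ρ(z) for all z ∈ J. If ϑ : J → ℝ is a continuously differentiable solution of N^{α,ψ}ϑ(z) = F(z, ϑ(z), (1/Γ(α)) ∫₀^z ψ'(τ)(ψ(z) − ψ(τ))^{α−1} H(z, τ, N^{α,ψ}ϑ(τ)) dτ) on J with ϑ(0) = ω(0), then for B = γ / (1 − W₁(1 + W₂)γ) one has |ω(z) − ϑ(z)| ≤ B ε ρ(z) for all z ∈ J. -/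
open MeasureTheory Set

/-- A scaled beta integral with complementary exponents. -/
lemma integral_rpow_mul_rpow_compl {α x y : ℝ} (hα0 : 0 < α) (hα1 : α < 1) (hxy : x < y) :
    ∫ u in x..y, (y - u) ^ (α - 1) * (u - x) ^ (-α) = Real.Gamma α * Real.Gamma (1 - α) := by
  have ha : 0 < y - x := sub_pos.2 hxy
  have hshift : ∫ u in x..y, (y - u) ^ (α - 1) * (u - x) ^ (-α) =
      ∫ t in (0 : ℝ)..(y - x), t ^ (-α) * ((y - x) - t) ^ (α - 1) := by
    rw [← sub_self x, ← intervalIntegral.integral_comp_sub_right]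
    refine intervalIntegral.integral_congr fun u _ => ?_
    simp only [sub_sub_sub_cancel_right]
    ring
  have hbeta := Complex.betaIntegral_scaled (1 - (α : ℂ)) α ha
  have hGG := Complex.Gamma_mul_Gamma_eq_betaIntegral (s := 1 - (α : ℂ)) (t := α)
    (by simpa using hα1) (by simpa using hα0)
  simp only [sub_add_cancel, Complex.Gamma_one, one_mul, sub_self, Complex.cpow_zero] at hbeta hGG
  rw [hshift, ← Complex.ofReal_inj, ← intervalIntegral.integral_ofReal, Complex.ofReal_mul,
    ← Complex.Gamma_ofReal, ← Complex.Gamma_ofReal, Complex.ofReal_sub, Complex.ofReal_one,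
    mul_comm, hGG, ← hbeta]
  refine intervalIntegral.integral_congr fun t ht => ?_
  rw [uIcc_of_le ha.le] at ht
  rw [Complex.ofReal_mul, Complex.ofReal_cpow ht.1, Complex.ofReal_cpow (sub_nonneg.2 ht.2)]
  push_cast
  congr 2
  ring

lemma intervalIntegrable_rpow_mul_rpow_compl {α x y : ℝ} (hα0 : 0 < α) (hα1 : α < 1)
    (hxy : x < y) :
    IntervalIntegrable (fun u => (y - u) ^ (α - 1) * (u - x) ^ (-α)) volume x y := by
  by_contra h
  have := intervalIntegral.integral_undef h
  rw [integral_rpow_mul_rpow_compl hα0 hα1 hxy] at this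
  exact (mul_pos (Real.Gamma_pos_of_pos hα0) (Real.Gamma_pos_of_pos (sub_pos.2 hα1))).ne' this

lemma integral_rpow_mul_exp_le {α l x y : ℝ} (hα : 0 < α) (hl : 0 < l) (hxy : x ≤ y) :
    ∫ u in x..y, (y - u) ^ (α - 1) * Real.exp (l * u) ≤
      (1 / l) ^ α * Real.Gamma α * Real.exp (l * y) := by
  have hval := Real.integral_rpow_mul_exp_neg_mul_Ioi hα hl
  have hint : IntegrableOn (fun t : ℝ => t ^ (α - 1) * Real.exp (-(l * t))) (Ioi 0) :=
    .of_integral_ne_zero (by rw [hval]; have := Real.Gamma_pos_of_pos hα; positivity)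
  have hshift : ∫ u in x..y, (y - u) ^ (α - 1) * Real.exp (l * u) =
      (∫ t in (0 : ℝ)..(y - x), t ^ (α - 1) * Real.exp (-(l * t))) * Real.exp (l * y) := by
    rw [← intervalIntegral.integral_mul_const, ← sub_self y,
      ← intervalIntegral.integral_comp_sub_left
        (fun t => t ^ (α - 1) * Real.exp (-(l * t)) * Real.exp (l * y)) y]
    refine intervalIntegral.integral_congr fun u _ => ?_
    simp only [mul_assoc, ← Real.exp_add]
    congr 3
    ring
  rw [hshift, ← hval, intervalIntegral.integral_of_le (sub_nonneg.2 hxy)]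
  refine mul_le_mul_of_nonneg_right
    (setIntegral_mono_set hint ?_ Ioc_subset_Ioi_self.eventuallyLE) (Real.exp_pos _).le
  filter_upwards [ae_restrict_mem measurableSet_Ioi] with t ht
  have : (0 : ℝ) < t := ht
  simp only [Pi.zero_apply]
  positivity

/-- A strictly monotone change of variable `ψ` on `[0, b]` with derivative `ψ'`, both extended
continuously to the whole line. -/
structure IsClock (b : ℝ) (ψ ψ' : ℝ → ℝ) : Prop where
  continuous : Continuous ψ
  continuous_deriv : Continuous ψ'
  strictMonoOn : StrictMonoOn ψ (Icc 0 b)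
  hasDerivWithinAt : ∀ z ∈ Icc 0 b, HasDerivWithinAt ψ (ψ' z) (Icc 0 b) z
  deriv_pos : ∀ z ∈ Icc 0 b, 0 < ψ' z

/-- `f` is almost everywhere strongly measurable and bounded on `[0, b]`. -/
def BoundedMeasurableOn (b : ℝ) (f : ℝ → ℝ) : Prop :=
  AEStronglyMeasurable f (volume.restrict (Icc 0 b)) ∧ ∃ C, ∀ t ∈ Icc 0 b, |f t| ≤ C

namespace BoundedMeasurableOn

variable {b : ℝ} {f g : ℝ → ℝ}

lemma of_continuousOn (hf : ContinuousOn f (Icc 0 b)) : BoundedMeasurableOn b f :=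
  ⟨hf.aestronglyMeasurable measurableSet_Icc, isCompact_Icc.exists_bound_of_continuousOn hf⟩

lemma add (hf : BoundedMeasurableOn b f) (hg : BoundedMeasurableOn b g) :
    BoundedMeasurableOn b fun t => f t + g t := by
  obtain ⟨hf, C, hC⟩ := hf
  obtain ⟨hg, D, hD⟩ := hg
  exact ⟨hf.add hg, C + D, fun t ht => (abs_add_le _ _).trans (add_le_add (hC t ht) (hD t ht))⟩

lemma const_mul (hf : BoundedMeasurableOn b f) (c : ℝ) :
    BoundedMeasurableOn b fun t => c * f t := by
  obtain ⟨hf, C, hC⟩ := hf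
  refine ⟨hf.const_mul c, |c| * C, fun t ht => ?_⟩
  rw [abs_mul]
  exact mul_le_mul_of_nonneg_left (hC t ht) (abs_nonneg c)

lemma abs_sub (hf : BoundedMeasurableOn b f) (hg : BoundedMeasurableOn b g) :
    BoundedMeasurableOn b fun t => |f t - g t| := by
  obtain ⟨hf, C, hC⟩ := hf
  obtain ⟨hg, D, hD⟩ := hg
  refine ⟨(hf.sub hg).norm, C + D, fun t ht => ?_⟩
  rw [abs_abs]
  exact (_root_.abs_sub _ _).trans (add_le_add (hC t ht) (hD t ht))

lemma comp_continuousOn (hb : 0 ≤ b) {G : ℝ → ℝ → ℝ}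
    (hG : ContinuousOn (fun p : ℝ × ℝ => G p.1 p.2) (Icc 0 b ×ˢ univ))
    (hf : BoundedMeasurableOn b f) : BoundedMeasurableOn b fun t => G t (f t) := by
  obtain ⟨hf, C, hC⟩ := hf
  constructor
  · have hc : Continuous fun p : ℝ × ℝ => G (projIcc 0 b hb p.1) p.2 :=
      hG.comp_continuous (f := fun p : ℝ × ℝ => ((projIcc 0 b hb p.1 : ℝ), p.2)) (by fun_prop)
        fun p => ⟨(projIcc 0 b hb p.1).2, mem_univ _⟩
    refine (hc.comp_aestronglyMeasurable
      (aestronglyMeasurable_id.prodMk hf)).congr ?_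
    filter_upwards [ae_restrict_mem measurableSet_Icc] with t ht
    simp [projIcc_of_mem hb ht]
  · obtain ⟨D, hD⟩ := (isCompact_Icc.prod isCompact_Icc).exists_bound_of_continuousOn
      (hG.mono (prod_mono_right (subset_univ (Icc (-C) C))))
    exact ⟨D, fun t ht => hD (t, f t) ⟨ht, abs_le.1 (hC t ht)⟩⟩

end BoundedMeasurableOn

namespace IsClock

variable {b : ℝ} {ψ ψ' : ℝ → ℝ} {s z : ℝ}

lemma image_Ioo (h : IsClock b ψ ψ') (hs : 0 ≤ s) (hsz : s ≤ z) (hz : z ≤ b) :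
    ψ '' Ioo s z = Ioo (ψ s) (ψ z) :=
  h.continuous.continuousOn.image_Ioo_of_strictMonoOn hsz
    (h.strictMonoOn.mono (Icc_subset_Icc hs hz))

lemma le_of_le (h : IsClock b ψ ψ') (hs : 0 ≤ s) (hsz : s ≤ z) (hz : z ≤ b) : ψ s ≤ ψ z :=
  h.strictMonoOn.monotoneOn ⟨hs, hsz.trans hz⟩ ⟨hs.trans hsz, hz⟩ hsz

lemma integral_comp (h : IsClock b ψ ψ') (hs : 0 ≤ s) (hsz : s ≤ z) (hz : z ≤ b) (f : ℝ → ℝ) :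
    ∫ t in s..z, ψ' t * f (ψ t) = ∫ u in ψ s..ψ z, f u := by
  have hsub : Ioo s z ⊆ Icc 0 b := Ioo_subset_Icc_self.trans (Icc_subset_Icc hs hz)
  rw [intervalIntegral.integral_of_le hsz, intervalIntegral.integral_of_le (h.le_of_le hs hsz hz),
    integral_Ioc_eq_integral_Ioo, integral_Ioc_eq_integral_Ioo, ← h.image_Ioo hs hsz hz,
    integral_image_eq_integral_abs_deriv_smul measurableSet_Ioo
      (fun t ht => (h.hasDerivWithinAt t (hsub ht)).mono hsub) (h.strictMonoOn.injOn.mono hsub)]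
  refine setIntegral_congr_fun measurableSet_Ioo fun t ht => ?_
  simp [abs_of_pos (h.deriv_pos t (hsub ht))]

lemma intervalIntegrable_comp (h : IsClock b ψ ψ') (hs : 0 ≤ s) (hsz : s ≤ z) (hz : z ≤ b)
    {f : ℝ → ℝ} (hf : IntervalIntegrable f volume (ψ s) (ψ z)) :
    IntervalIntegrable (fun t => ψ' t * f (ψ t)) volume s z := by
  have hsub : Ioo s z ⊆ Icc 0 b := Ioo_subset_Icc_self.trans (Icc_subset_Icc hs hz)
  rw [intervalIntegrable_iff_integrableOn_Ioo_of_le (h.le_of_le hs hsz hz), ← h.image_Ioo hs hsz hz,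
    integrableOn_image_iff_integrableOn_abs_deriv_smul measurableSet_Ioo
      (fun t ht => (h.hasDerivWithinAt t (hsub ht)).mono hsub)
      (h.strictMonoOn.injOn.mono hsub)] at hf
  rw [intervalIntegrable_iff_integrableOn_Ioo_of_le hsz]
  refine hf.congr_fun (fun t ht => ?_) measurableSet_Ioo
  simp [abs_of_pos (h.deriv_pos t (hsub ht))]

lemma intervalIntegrable_kernel (h : IsClock b ψ ψ') {r : ℝ} (hr : -1 < r) (hz : z ∈ Icc 0 b) :
    IntervalIntegrable (fun t => ψ' t * (ψ z - ψ t) ^ r) volume 0 z := by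
  refine h.intervalIntegrable_comp le_rfl hz.1 hz.2 (f := fun u => (ψ z - u) ^ r) ?_
  have := (intervalIntegral.intervalIntegrable_rpow' (a := ψ z - ψ 0) (b := ψ z - ψ z)
    hr).comp_sub_left (ψ z)
  simpa using this

lemma integral_kernel_le (h : IsClock b ψ ψ') {r : ℝ} (hr : -1 < r) (hz : z ∈ Icc 0 b) :
    ∫ t in (0 : ℝ)..z, ψ' t * (ψ z - ψ t) ^ r ≤ (ψ b - ψ 0) ^ (r + 1) / (r + 1) := by
  rw [h.integral_comp le_rfl hz.1 hz.2 (fun u => (ψ z - u) ^ r),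
    intervalIntegral.integral_comp_sub_left (fun u => u ^ r), integral_rpow (Or.inl hr), sub_self,
    Real.zero_rpow (by linarith), sub_zero]
  have h0 := h.le_of_le le_rfl hz.1 hz.2
  have h1 := h.le_of_le hz.1 hz.2 le_rfl
  have : 0 < r + 1 := by linarith
  gcongr

lemma kernel_nonneg (h : IsClock b ψ ψ') (r : ℝ) {t : ℝ} (ht : 0 ≤ t) (htz : t ≤ z) (hz : z ≤ b) :
    0 ≤ ψ' t * (ψ z - ψ t) ^ r :=
  mul_nonneg (h.deriv_pos t ⟨ht, htz.trans hz⟩).le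
    (Real.rpow_nonneg (sub_nonneg.2 (h.le_of_le ht htz hz)) r)

lemma integral_beta_kernel (h : IsClock b ψ ψ') {α : ℝ} (hα0 : 0 < α) (hα1 : α < 1)
    (hs : 0 ≤ s) (hsz : s < z) (hz : z ≤ b) :
    ∫ t in s..z, ψ' t * ((ψ z - ψ t) ^ (α - 1) * (ψ t - ψ s) ^ (-α)) =
      Real.Gamma α * Real.Gamma (1 - α) := by
  rw [h.integral_comp hs hsz.le hz (fun u => (ψ z - u) ^ (α - 1) * (u - ψ s) ^ (-α)),
    integral_rpow_mul_rpow_compl hα0 hα1 (h.strictMonoOn ⟨hs, hsz.le.trans hz⟩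
      ⟨hs.trans hsz.le, hz⟩ hsz)]

lemma intervalIntegrable_beta_kernel (h : IsClock b ψ ψ') {α : ℝ} (hα0 : 0 < α) (hα1 : α < 1)
    (hs : 0 ≤ s) (hsz : s < z) (hz : z ≤ b) :
    IntervalIntegrable (fun t => ψ' t * ((ψ z - ψ t) ^ (α - 1) * (ψ t - ψ s) ^ (-α)))
      volume s z :=
  h.intervalIntegrable_comp hs hsz.le hz (f := fun u => (ψ z - u) ^ (α - 1) * (u - ψ s) ^ (-α))
    (intervalIntegrable_rpow_mul_rpow_compl hα0 hα1 (h.strictMonoOn ⟨hs, hsz.le.trans hz⟩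
      ⟨hs.trans hsz.le, hz⟩ hsz))

/-- The product of a fractional kernel and a bounded measurable function is integrable. -/
lemma intervalIntegrable_kernel_mul (h : IsClock b ψ ψ') {r : ℝ} (hr : -1 < r)
    (hz : z ∈ Icc 0 b) {f : ℝ → ℝ} (hf : BoundedMeasurableOn b f) :
    IntervalIntegrable (fun t => ψ' t * (ψ z - ψ t) ^ r * f t) volume 0 z := by
  have hsub : Ioc 0 z ⊆ Icc 0 b := fun t ht => ⟨ht.1.le, ht.2.trans hz.2⟩
  obtain ⟨hf, C, hfC⟩ := hf
  have hk := h.intervalIntegrable_kernel hr hz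
  rw [intervalIntegrable_iff_integrableOn_Ioc_of_le hz.1] at hk ⊢
  refine Integrable.mul_bdd (c := C) hk (hf.mono_measure (Measure.restrict_mono_set _ hsub)) ?_
  filter_upwards [ae_restrict_mem measurableSet_Ioc] with t ht
  exact hfC t (hsub ht)

lemma psiInt_mono (h : IsClock b ψ ψ') {α : ℝ} (hα : 0 < α) (hz : z ∈ Icc 0 b) {f g : ℝ → ℝ}
    (hf : BoundedMeasurableOn b f)
    (hg : BoundedMeasurableOn b g)
    (hfg : ∀ t ∈ Icc 0 b, f t ≤ g t) : psiInt α ψ ψ' f z ≤ psiInt α ψ ψ' g z := by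
  have := Real.Gamma_pos_of_pos hα
  unfold psiInt
  gcongr
  refine intervalIntegral.integral_mono_on hz.1
    (h.intervalIntegrable_kernel_mul (by linarith) hz hf)
    (h.intervalIntegrable_kernel_mul (by linarith) hz hg) fun t ht => ?_
  exact mul_le_mul_of_nonneg_left (hfg t ⟨ht.1, ht.2.trans hz.2⟩) (h.kernel_nonneg _ ht.1 ht.2 hz.2)

lemma psiInt_add (h : IsClock b ψ ψ') {α : ℝ} (hα : 0 < α) (hz : z ∈ Icc 0 b) {f g : ℝ → ℝ}
    (hf : BoundedMeasurableOn b f)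
    (hg : BoundedMeasurableOn b g) :
    psiInt α ψ ψ' (fun t => f t + g t) z = psiInt α ψ ψ' f z + psiInt α ψ ψ' g z := by
  unfold psiInt
  rw [← mul_add, ← intervalIntegral.integral_add
    (h.intervalIntegrable_kernel_mul (by linarith) hz hf)
    (h.intervalIntegrable_kernel_mul (by linarith) hz hg)]
  simp only [mul_add]

lemma psiInt_exp_le (h : IsClock b ψ ψ') {α l : ℝ} (hα : 0 < α) (hl : 0 < l) (hz : z ∈ Icc 0 b) :
    psiInt α ψ ψ' (fun t => Real.exp (l * ψ t)) z ≤ (1 / l) ^ α * Real.exp (l * ψ z) := by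
  have hG := Real.Gamma_pos_of_pos hα
  have := integral_rpow_mul_exp_le hα hl (h.le_of_le le_rfl hz.1 hz.2)
  unfold psiInt
  simp only [mul_assoc]
  rw [h.integral_comp le_rfl hz.1 hz.2 (fun u => (ψ z - u) ^ (α - 1) * Real.exp (l * u))]
  calc _ ≤ 1 / Real.Gamma α * ((1 / l) ^ α * Real.Gamma α * Real.exp (l * ψ z)) := by gcongr
    _ = _ := by field_simp

end IsClock

lemma psiInt_const_mul (α : ℝ) (ψ ψ' f : ℝ → ℝ) (c z : ℝ) :
    psiInt α ψ ψ' (fun t => c * f t) z = c * psiInt α ψ ψ' f z := by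
  unfold psiInt
  simp only [mul_left_comm _ c, intervalIntegral.integral_const_mul]

namespace IsClock

variable {b : ℝ} {ψ ψ' : ℝ → ℝ} {s z : ℝ}

lemma integrable_beta_kernel_indicator (h : IsClock b ψ ψ') {α : ℝ} (hα0 : 0 < α) (hα1 : α < 1)
    (hs : 0 ≤ s) (hsz : s < z) (hz : z ≤ b) :
    Integrable ((Ioi s).indicator fun t => ψ' t * ((ψ z - ψ t) ^ (α - 1) * (ψ t - ψ s) ^ (-α)))
      (volume.restrict (Ioc 0 z)) := by
  have hset : Ioi s ∩ Ioc 0 z = Ioc s z := by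
    rw [inter_comm, Ioc_inter_Ioi, max_eq_right hs]
  rw [integrable_indicator_iff measurableSet_Ioi, IntegrableOn,
    Measure.restrict_restrict measurableSet_Ioi, hset]
  exact (intervalIntegrable_iff_integrableOn_Ioc_of_le hsz.le).1
    (h.intervalIntegrable_beta_kernel hα0 hα1 hs hsz hz)

lemma integral_beta_kernel_indicator (h : IsClock b ψ ψ') {α : ℝ} (hα0 : 0 < α) (hα1 : α < 1)
    (hs : 0 ≤ s) (hsz : s < z) (hz : z ≤ b) :
    ∫ t in Ioc 0 z,
      (Ioi s).indicator (fun t => ψ' t * ((ψ z - ψ t) ^ (α - 1) * (ψ t - ψ s) ^ (-α))) t =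
      Real.Gamma α * Real.Gamma (1 - α) := by
  have hset : Ioi s ∩ Ioc 0 z = Ioc s z := by
    rw [inter_comm, Ioc_inter_Ioi, max_eq_right hs]
  rw [integral_indicator measurableSet_Ioi, Measure.restrict_restrict measurableSet_Ioi, hset,
    ← intervalIntegral.integral_of_le hsz.le, h.integral_beta_kernel hα0 hα1 hs hsz hz]

/-- The fractional integral is a left inverse of the Caputo derivative, up to the initial value. -/
lemma psiInt_psiCaputo (h : IsClock b ψ ψ') {α : ℝ} (hα0 : 0 < α) (hα1 : α < 1)
    (hz : z ∈ Icc 0 b) {d : ℝ → ℝ} (hd : Continuous d) :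
    psiInt α ψ ψ' (psiCaputo α ψ ψ' d) z = ∫ s in (0 : ℝ)..z, d s := by
  have hG0 := (Real.Gamma_pos_of_pos hα0).ne'
  have hG1 := (Real.Gamma_pos_of_pos (sub_pos.2 hα1)).ne'
  set K : ℝ → ℝ → ℝ := fun t s => (Ioi s).indicator
    (fun t => ψ' t * ((ψ z - ψ t) ^ (α - 1) * (ψ t - ψ s) ^ (-α))) t with hK
  have hKnn : ∀ t ∈ Ioc 0 z, ∀ s ∈ Ioc 0 z, 0 ≤ K t s := fun t ht s hs =>
    indicator_apply_nonneg fun hst => by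
      rw [← mul_assoc]
      exact mul_nonneg (h.kernel_nonneg _ ht.1.le ht.2 hz.2) (Real.rpow_nonneg (sub_nonneg.2
        (h.le_of_le hs.1.le (le_of_lt hst) (ht.2.trans hz.2))) _)
  have hmeas : Measurable (Function.uncurry fun t s => K t s * d s) := by
    have h1 := h.continuous.measurable
    have h2 := h.continuous_deriv.measurable
    have h3 := hd.measurable
    have : (Function.uncurry fun t s => K t s * d s) = {p : ℝ × ℝ | p.2 < p.1}.indicator
        (fun p => ψ' p.1 * ((ψ z - ψ p.1) ^ (α - 1) * (ψ p.1 - ψ p.2) ^ (-α)) * d p.2) := by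
      ext ⟨t, s⟩
      by_cases hst : s < t <;> simp [hK, hst, indicator]
    rw [this]
    exact Measurable.indicator (by fun_prop) (measurableSet_lt measurable_snd measurable_fst)
  have hae : ∀ᵐ s ∂volume.restrict (Ioc 0 z), s ∈ Ioo 0 z := by
    rw [← restrict_Ioo_eq_restrict_Ioc]
    exact ae_restrict_mem measurableSet_Ioo
  have hint : Integrable (Function.uncurry fun t s => K t s * d s)
      ((volume.restrict (Ioc 0 z)).prod (volume.restrict (Ioc 0 z))) := by
    refine (integrable_prod_iff' hmeas.aestronglyMeasurable).2 ⟨?_, ?_⟩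
    · filter_upwards [hae] with s hs
      exact (h.integrable_beta_kernel_indicator hα0 hα1 hs.1.le hs.2 hz.2).mul_const (d s)
    · have : Integrable (fun s => Real.Gamma α * Real.Gamma (1 - α) * |d s|)
          (volume.restrict (Ioc 0 z)) :=
        ((hd.abs.integrableOn_Icc (a := 0) (b := z)).mono_set Ioc_subset_Icc_self).const_mul _
      refine this.congr ?_
      filter_upwards [hae] with s hs
      rw [← h.integral_beta_kernel_indicator hα0 hα1 hs.1.le hs.2 hz.2, ← integral_mul_const]
      refine setIntegral_congr_fun measurableSet_Ioc fun t ht => ?_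
      simp only [Function.uncurry, norm_mul, Real.norm_eq_abs]
      rw [abs_of_nonneg (hKnn t ht s ⟨hs.1, hs.2.le⟩)]
  have hswap := integral_integral_swap hint
  have hleft : ∀ t ∈ Ioc 0 z, ∫ s in Ioc 0 z, K t s * d s =
      Real.Gamma (1 - α) * (ψ' t * (ψ z - ψ t) ^ (α - 1) * psiCaputo α ψ ψ' d t) := by
    intro t ht
    have hset : Iio t ∩ Ioc 0 z = Ioo 0 t := by
      ext s
      simp only [mem_inter_iff, mem_Iio, mem_Ioc, mem_Ioo]
      exact ⟨fun hs => ⟨hs.2.1, hs.1⟩, fun hs => ⟨hs.2, hs.1, (hs.2.trans_le ht.2).le⟩⟩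
    have : (fun s => K t s * d s) = (Iio t).indicator
        fun s => ψ' t * ((ψ z - ψ t) ^ (α - 1) * (ψ t - ψ s) ^ (-α)) * d s := by
      ext s
      by_cases hst : s < t <;> simp [hK, hst, indicator]
    rw [this, integral_indicator measurableSet_Iio, Measure.restrict_restrict measurableSet_Iio,
      hset, psiCaputo, intervalIntegral.integral_of_le ht.1.le, integral_Ioc_eq_integral_Ioo]
    have hpull : ∀ A I : ℝ, Real.Gamma (1 - α) * (A * (1 / Real.Gamma (1 - α) * I)) = A * I := by
      intro A I
      field_simp
    rw [hpull, ← integral_const_mul]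
    refine setIntegral_congr_fun measurableSet_Ioo fun s hs => ?_
    have := (h.deriv_pos s ⟨hs.1.le, (hs.2.le.trans ht.2).trans hz.2⟩).ne'
    field_simp
  have hright : ∫ s in Ioc 0 z, ∫ t in Ioc 0 z, K t s * d s =
      Real.Gamma α * Real.Gamma (1 - α) * ∫ s in (0 : ℝ)..z, d s := by
    rw [intervalIntegral.integral_of_le hz.1, ← integral_const_mul]
    refine integral_congr_ae ?_
    filter_upwards [hae] with s hs
    rw [integral_mul_const, h.integral_beta_kernel_indicator hα0 hα1 hs.1.le hs.2 hz.2]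
  rw [hright, setIntegral_congr_fun measurableSet_Ioc hleft, integral_const_mul] at hswap
  rw [psiInt, intervalIntegral.integral_of_le hz.1]
  refine mul_left_cancel₀ (mul_ne_zero hG0 hG1) ?_
  rw [← hswap]
  field_simp

lemma aestronglyMeasurable_psiCaputo (h : IsClock b ψ ψ') {α : ℝ} {d : ℝ → ℝ} (hd : Continuous d) :
    AEStronglyMeasurable (psiCaputo α ψ ψ' d) (volume.restrict (Icc 0 b)) := by
  have h1 := h.continuous.measurable
  have h2 := h.continuous_deriv.measurable
  have h3 := hd.measurable
  have hm : Measurable ({p : ℝ × ℝ | 0 < p.2 ∧ p.2 ≤ p.1}.indicator fun p =>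
      ψ' p.2 * (ψ p.1 - ψ p.2) ^ (-α) * (d p.2 / ψ' p.2)) :=
    Measurable.indicator (by fun_prop) ((measurableSet_lt measurable_const measurable_snd).inter
      (measurableSet_le measurable_snd measurable_fst))
  refine ((hm.stronglyMeasurable.integral_prod_right' (ν := volume)).const_mul
    (1 / Real.Gamma (1 - α))).aestronglyMeasurable.congr ?_
  filter_upwards [ae_restrict_mem measurableSet_Icc] with t ht
  rw [psiCaputo, intervalIntegral.integral_of_le ht.1, ← integral_indicator measurableSet_Ioc]
  rfl

lemma exists_psiCaputo_bound (h : IsClock b ψ ψ') {α : ℝ} (hα1 : α < 1)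
    {d : ℝ → ℝ} (hd : Continuous d) :
    ∃ C, ∀ t ∈ Icc 0 b, |psiCaputo α ψ ψ' d t| ≤ C := by
  have hG := Real.Gamma_pos_of_pos (sub_pos.2 hα1)
  obtain ⟨M, hM⟩ := isCompact_Icc.exists_bound_of_continuousOn (s := Icc 0 b)
    (hd.continuousOn.div h.continuous_deriv.continuousOn fun t ht => (h.deriv_pos t ht).ne')
  simp only [Real.norm_eq_abs] at hM
  refine ⟨1 / Real.Gamma (1 - α) * ((ψ b - ψ 0) ^ (-α + 1) / (-α + 1) * M), fun t ht => ?_⟩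
  have hM0 : 0 ≤ M := (abs_nonneg _).trans (hM t ht)
  rw [psiCaputo, abs_mul, abs_of_pos (one_div_pos.2 hG)]
  gcongr
  calc _ ≤ ∫ κ in (0 : ℝ)..t, ψ' κ * (ψ t - ψ κ) ^ (-α) * M := by
        rw [← Real.norm_eq_abs]
        refine intervalIntegral.norm_integral_le_of_norm_le ht.1 (ae_of_all _ fun κ hκ => ?_)
          ((h.intervalIntegrable_kernel (by linarith) ht).mul_const M)
        have hk := h.kernel_nonneg (-α) hκ.1.le hκ.2 ht.2
        rw [norm_mul, Real.norm_of_nonneg hk]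
        exact mul_le_mul_of_nonneg_left (hM κ ⟨hκ.1.le, hκ.2.trans ht.2⟩) hk
    _ ≤ _ := by
        rw [intervalIntegral.integral_mul_const]
        exact mul_le_mul_of_nonneg_right (h.integral_kernel_le (by linarith) ht) hM0

lemma boundedMeasurableOn_psiCaputo (h : IsClock b ψ ψ') {α : ℝ} (hα1 : α < 1) {d : ℝ → ℝ}
    (hd : Continuous d) : BoundedMeasurableOn b (psiCaputo α ψ ψ' d) :=
  ⟨h.aestronglyMeasurable_psiCaputo hd, h.exists_psiCaputo_bound hα1 hd⟩

end IsClock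

namespace IsClock

variable {b : ℝ} {ψ ψ' : ℝ → ℝ} {z : ℝ}

lemma abs_psiInt_sub_le (h : IsClock b ψ ψ') {α : ℝ} (hα : 0 < α) (hz : z ∈ Icc 0 b)
    {f g w : ℝ → ℝ} (hf : BoundedMeasurableOn b f) (hg : BoundedMeasurableOn b g)
    (hw : BoundedMeasurableOn b w) (hfg : ∀ t ∈ Icc 0 b, |f t - g t| ≤ w t) :
    |psiInt α ψ ψ' f z - psiInt α ψ ψ' g z| ≤ psiInt α ψ ψ' w z := by
  have h1 := h.psiInt_mono hα hz hf (hg.add hw) fun t ht => by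
    linarith [(abs_le.1 (hfg t ht)).2]
  have h2 := h.psiInt_mono hα hz hg (hf.add hw) fun t ht => by
    linarith [(abs_le.1 (hfg t ht)).1]
  rw [h.psiInt_add hα hz hg hw] at h1
  rw [h.psiInt_add hα hz hf hw] at h2
  exact abs_le.2 ⟨by linarith, by linarith⟩

/-- A Gronwall inequality with a positive weight that is an approximate eigenfunction of the
fractional integral. -/
lemma le_of_le_add_psiInt_of_pos (h : IsClock b ψ ψ') {α : ℝ} (hα : 0 < α) (hb : 0 ≤ b)
    {g σ : ℝ → ℝ} (hg : BoundedMeasurableOn b g) (hσ : BoundedMeasurableOn b σ) {m : ℝ}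
    (hm : 0 < m) (hmσ : ∀ t ∈ Icc 0 b, m ≤ σ t) {γ c ε : ℝ} (hc : 0 ≤ c) (hcγ : c * γ < 1)
    (hσγ : ∀ t ∈ Icc 0 b, psiInt α ψ ψ' σ t ≤ γ * σ t)
    (hg0 : ∀ t ∈ Icc 0 b, 0 ≤ g t)
    (hgle : ∀ t ∈ Icc 0 b, g t ≤ ε * σ t + c * psiInt α ψ ψ' g t) :
    ∀ t ∈ Icc 0 b, g t ≤ ε / (1 - c * γ) * σ t := by
  obtain ⟨C, hC⟩ := hg.2
  have hσ0 : ∀ t ∈ Icc 0 b, 0 < σ t := fun t ht => hm.trans_le (hmσ t ht)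
  have hbdd : BddAbove ((fun t => g t / σ t) '' Icc 0 b) := by
    refine ⟨C / m, ?_⟩
    rintro _ ⟨t, ht, rfl⟩
    exact div_le_div₀ ((abs_nonneg _).trans (hC t ht)) ((le_abs_self _).trans (hC t ht)) hm
      (hmσ t ht)
  set M := sSup ((fun t => g t / σ t) '' Icc 0 b) with hM
  have hgM : ∀ t ∈ Icc 0 b, g t ≤ M * σ t := fun t ht =>
    (div_le_iff₀ (hσ0 t ht)).1 (le_csSup hbdd ⟨t, ht, rfl⟩)
  have hM0 : 0 ≤ M := Real.sSup_nonneg (by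
    rintro _ ⟨t, ht, rfl⟩
    exact div_nonneg (hg0 t ht) (hσ0 t ht).le)
  have hMle : M ≤ ε + c * (M * γ) := by
    refine csSup_le ⟨_, 0, ⟨le_rfl, hb⟩, rfl⟩ ?_
    rintro _ ⟨t, ht, rfl⟩
    have h1 := h.psiInt_mono hα ht hg (hσ.const_mul M) hgM
    rw [psiInt_const_mul] at h1
    have h2 := h1.trans (mul_le_mul_of_nonneg_left (hσγ t ht) hM0)
    refine (div_le_iff₀ (hσ0 t ht)).2 ((hgle t ht).trans ?_)
    linarith [mul_le_mul_of_nonneg_left h2 hc]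
  intro t ht
  refine (hgM t ht).trans (mul_le_mul_of_nonneg_right ?_ (hσ0 t ht).le)
  rw [le_div_iff₀ (by linarith)]
  linarith

/-- A Gronwall inequality for the fractional integral with a weight that may vanish. -/
lemma psiInt_le_of_le_add_psiInt (h : IsClock b ψ ψ') {α : ℝ} (hα : 0 < α) (hb : 0 ≤ b)
    {g ρ : ℝ → ℝ} (hg : BoundedMeasurableOn b g) (hρ : BoundedMeasurableOn b ρ)
    (hρ0 : ∀ t ∈ Icc 0 b, 0 ≤ ρ t) {γ c ε : ℝ} (hγ : 0 < γ) (hc : 0 ≤ c) (hε : 0 < ε)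
    (hcγ : c * γ < 1) (hργ : ∀ t ∈ Icc 0 b, psiInt α ψ ψ' ρ t ≤ γ * ρ t)
    (hg0 : ∀ t ∈ Icc 0 b, 0 ≤ g t)
    (hgle : ∀ t ∈ Icc 0 b, g t ≤ ε * ρ t + c * psiInt α ψ ψ' g t) (hz : z ∈ Icc 0 b) :
    psiInt α ψ ψ' g z ≤ γ / (1 - c * γ) * ε * ρ z := by
  have hden : 0 < 1 - c * γ := by linarith
  obtain ⟨l, hl, hlγ⟩ : ∃ l : ℝ, 0 < l ∧ (1 / l) ^ α = γ := by
    refine ⟨1 / γ ^ (1 / α), by positivity, ?_⟩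
    rw [one_div_one_div, ← Real.rpow_mul hγ.le, one_div_mul_cancel hα.ne', Real.rpow_one]
  set E : ℝ → ℝ := fun t => Real.exp (l * ψ t) with hE
  have hEpos : ∀ t, 0 < E t := fun t => Real.exp_pos _
  have hEmeas : BoundedMeasurableOn b E :=
    .of_continuousOn (Real.continuous_exp.comp (h.continuous.const_mul l)).continuousOn
  have hEγ : ∀ t ∈ Icc 0 b, psiInt α ψ ψ' E t ≤ γ * E t := fun t ht =>
    hlγ ▸ h.psiInt_exp_le hα hl ht
  refine le_of_forall_pos_le_add fun η hη => ?_
  set B := γ / (1 - c * γ) * ε with hB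
  have hBpos : 0 < B := by positivity
  set δ := η / (B * E z) with hδ
  have hδ0 : 0 < δ := div_pos hη (mul_pos hBpos (hEpos z))
  have hσ := hρ.add (hEmeas.const_mul δ)
  have hσγ : ∀ t ∈ Icc 0 b,
      psiInt α ψ ψ' (fun t => ρ t + δ * E t) t ≤ γ * (ρ t + δ * E t) := fun t ht => by
    rw [h.psiInt_add hα ht hρ (hEmeas.const_mul δ), psiInt_const_mul]
    linarith [hργ t ht, mul_le_mul_of_nonneg_left (hEγ t ht) hδ0.le]
  have hgσ := h.le_of_le_add_psiInt_of_pos hα hb hg hσ (mul_pos hδ0 (hEpos 0))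
    (fun t ht => by
      have : E 0 ≤ E t := Real.exp_le_exp.2
        (mul_le_mul_of_nonneg_left (h.le_of_le le_rfl ht.1 ht.2) hl.le)
      linarith [hρ0 t ht, mul_le_mul_of_nonneg_left this hδ0.le])
    hc hcγ hσγ hg0 (ε := ε) fun t ht => by
      linarith [hgle t ht, mul_pos hε (mul_pos hδ0 (hEpos t))]
  have h1 := h.psiInt_mono hα hz hg (hσ.const_mul _) hgσ
  rw [psiInt_const_mul] at h1
  calc _ ≤ ε / (1 - c * γ) * (γ * (ρ z + δ * E z)) :=
        h1.trans (mul_le_mul_of_nonneg_left (hσγ z hz) (by positivity))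
    _ = B * ρ z + δ * (B * E z) := by rw [hB]; ring
    _ = _ := by rw [hδ, div_mul_cancel₀ _ (mul_pos hBpos (hEpos z)).ne']

lemma psiInt_psiCaputo_of_hasDerivWithinAt (h : IsClock b ψ ψ') {α : ℝ} (hα0 : 0 < α)
    (hα1 : α < 1) (hz : z ∈ Icc 0 b) {w d : ℝ → ℝ} (hd : Continuous d)
    (hwd : ∀ t ∈ Icc 0 b, HasDerivWithinAt w (d t) (Icc 0 b) t) :
    psiInt α ψ ψ' (psiCaputo α ψ ψ' d) z = w z - w 0 := by
  rw [h.psiInt_psiCaputo hα0 hα1 hz hd]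
  have hsub : Icc 0 z ⊆ Icc 0 b := Icc_subset_Icc_right hz.2
  refine intervalIntegral.integral_eq_sub_of_hasDerivAt_of_le hz.1
    (fun t ht => ((hwd t (hsub ht)).mono hsub).continuousWithinAt) (fun t ht => ?_)
    (hd.intervalIntegrable _ _)
  exact (hwd t (hsub (Ioo_subset_Icc_self ht))).hasDerivAt
    (Icc_mem_nhds ht.1 (ht.2.trans_le hz.2))

/-- Ulam–Hyers–Rassias stability for a globally continuous clock and globally continuous
derivatives of the approximate and exact solutions. -/
lemma ulam_hyers_rassias (h : IsClock b ψ ψ') {α : ℝ} (hα0 : 0 < α) (hα1 : α < 1)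
    (hb : 0 ≤ b) {F H : ℝ → ℝ → ℝ → ℝ}
    (hH : ContinuousOn (fun p : ℝ × ℝ × ℝ => H p.1 p.2.1 p.2.2) (Icc 0 b ×ˢ Icc 0 b ×ˢ univ))
    {W₁ W₂ : ℝ} (hW₁ : 0 ≤ W₁) (hW₂ : 0 ≤ W₂)
    (hF : ∀ z ∈ Icc 0 b, ∀ u₁ u₂ w₁ w₂ : ℝ,
      |F z u₁ u₂ - F z w₁ w₂| ≤ W₁ * (|u₁ - w₁| + |u₂ - w₂|))
    (hHW : ∀ z ∈ Icc 0 b, ∀ τ ∈ Icc 0 b, ∀ u w : ℝ, |H z τ u - H z τ w| ≤ W₂ * |u - w|)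
    {ρ : ℝ → ℝ} (hρ : ContinuousOn ρ (Icc 0 b)) (hρ0 : ∀ z ∈ Icc 0 b, 0 ≤ ρ z)
    {γ : ℝ} (hγ : 0 < γ) (hργ : ∀ z ∈ Icc 0 b, psiInt α ψ ψ' ρ z ≤ γ * ρ z)
    (hsmall : W₁ * (1 + W₂) * γ < 1) {ε : ℝ} (hε : 0 < ε)
    {ω ω' v v' : ℝ → ℝ} (hω' : Continuous ω') (hv' : Continuous v')
    (hω : ∀ z ∈ Icc 0 b, HasDerivWithinAt ω (ω' z) (Icc 0 b) z)
    (hv : ∀ z ∈ Icc 0 b, HasDerivWithinAt v (v' z) (Icc 0 b) z)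
    (hω_approx : ∀ z ∈ Icc 0 b, |psiCaputo α ψ ψ' ω' z -
        F z (ω z) (psiInt α ψ ψ' (fun τ => H z τ (psiCaputo α ψ ψ' ω' τ)) z)| ≤ ε * ρ z)
    (hv_sol : ∀ z ∈ Icc 0 b, psiCaputo α ψ ψ' v' z =
        F z (v z) (psiInt α ψ ψ' (fun τ => H z τ (psiCaputo α ψ ψ' v' τ)) z))
    (hv0 : v 0 = ω 0) (hz : z ∈ Icc 0 b) :
    |ω z - v z| ≤ γ / (1 - W₁ * (1 + W₂) * γ) * ε * ρ z := by
  set p := psiCaputo α ψ ψ' ω'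
  set q := psiCaputo α ψ ψ' v'
  have hp : BoundedMeasurableOn b p := h.boundedMeasurableOn_psiCaputo hα1 hω'
  have hq : BoundedMeasurableOn b q := h.boundedMeasurableOn_psiCaputo hα1 hv'
  have hg := hp.abs_sub hq
  have hdiff : ∀ z ∈ Icc 0 b, |ω z - v z| ≤ psiInt α ψ ψ' (fun t => |p t - q t|) z := by
    intro z hz
    have hpω : psiInt α ψ ψ' p z = ω z - ω 0 :=
      h.psiInt_psiCaputo_of_hasDerivWithinAt hα0 hα1 hz hω' hω
    have hqv : psiInt α ψ ψ' q z = v z - v 0 :=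
      h.psiInt_psiCaputo_of_hasDerivWithinAt hα0 hα1 hz hv' hv
    have := h.abs_psiInt_sub_le hα0 hz hp hq hg fun t _ => le_rfl
    rwa [hpω, hqv, hv0, sub_sub_sub_cancel_right] at this
  have hHcomp : ∀ z ∈ Icc 0 b, ∀ {f : ℝ → ℝ}, BoundedMeasurableOn b f →
      BoundedMeasurableOn b fun τ => H z τ (f τ) := fun z hz f hf =>
    hf.comp_continuousOn hb (hH.comp (f := fun x : ℝ × ℝ => (z, x.1, x.2))
      (by fun_prop) fun x hx => ⟨hz, hx.1, hx.2⟩)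
  refine (hdiff z hz).trans (h.psiInt_le_of_le_add_psiInt hα0 hb hg (.of_continuousOn hρ) hρ0 hγ
    (mul_nonneg hW₁ (by linarith)) hε hsmall hργ (fun t _ => abs_nonneg _) (fun t ht => ?_) hz)
  have hHdiff := h.abs_psiInt_sub_le hα0 ht (hHcomp t ht hp) (hHcomp t ht hq) (hg.const_mul W₂)
    (fun τ hτ => hHW t ht τ hτ _ _)
  rw [psiInt_const_mul] at hHdiff
  have hFdiff := (hF t ht (ω t) (psiInt α ψ ψ' (fun τ => H t τ (p τ)) t) (v t)
    (psiInt α ψ ψ' (fun τ => H t τ (q τ)) t)).trans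
    (mul_le_mul_of_nonneg_left (add_le_add (hdiff t ht) hHdiff) hW₁)
  rw [← hv_sol t ht] at hFdiff
  have := abs_sub_le (p t) (F t (ω t) (psiInt α ψ ψ' (fun τ => H t τ (p τ)) t)) (q t)
  linarith [hω_approx t ht]

end IsClock

lemma psiInt_congr {α b z : ℝ} {ψ₁ ψ₂ ψ₁' ψ₂' f₁ f₂ : ℝ → ℝ} (hψ : EqOn ψ₁ ψ₂ (Icc 0 b))
    (hψ' : EqOn ψ₁' ψ₂' (Icc 0 b)) (hf : EqOn f₁ f₂ (Icc 0 b)) (hz : z ∈ Icc 0 b) :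
    psiInt α ψ₁ ψ₁' f₁ z = psiInt α ψ₂ ψ₂' f₂ z := by
  unfold psiInt
  congr 1
  refine intervalIntegral.integral_congr fun t ht => ?_
  rw [uIcc_of_le hz.1] at ht
  have ht' : t ∈ Icc 0 b := ⟨ht.1, ht.2.trans hz.2⟩
  simp only [hψ hz, hψ ht', hψ' ht', hf ht']

lemma psiCaputo_congr {α b z : ℝ} {ψ₁ ψ₂ ψ₁' ψ₂' d₁ d₂ : ℝ → ℝ} (hψ : EqOn ψ₁ ψ₂ (Icc 0 b))
    (hψ' : EqOn ψ₁' ψ₂' (Icc 0 b)) (hd : EqOn d₁ d₂ (Icc 0 b)) (hz : z ∈ Icc 0 b) :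
    psiCaputo α ψ₁ ψ₁' d₁ z = psiCaputo α ψ₂ ψ₂' d₂ z := by
  unfold psiCaputo
  congr 1
  refine intervalIntegral.integral_congr fun t ht => ?_
  rw [uIcc_of_le hz.1] at ht
  have ht' : t ∈ Icc 0 b := ⟨ht.1, ht.2.trans hz.2⟩
  simp only [hψ hz, hψ ht', hψ' ht', hd ht']

lemma exists_continuous_eqOn_Icc {a b : ℝ} (hab : a ≤ b) {f : ℝ → ℝ}
    (hf : ContinuousOn f (Icc a b)) : ∃ g, Continuous g ∧ EqOn g f (Icc a b) :=
  ⟨IccExtend hab ((Icc a b).domRestrict f), hf.domRestrict.Icc_extend', fun t ht => by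
    rw [IccExtend_of_mem hab _ ht, domRestrict_apply]⟩

lemma le_sSup_abs_image {b : ℝ} {f : ℝ → ℝ} (hf : ContinuousOn f (Icc 0 b)) :
    ∀ z ∈ Icc 0 b, f z ≤ sSup ((fun z => |f z|) '' Icc 0 b) := fun z hz =>
  (le_abs_self _).trans (le_csSup (isCompact_Icc.image_of_continuousOn hf.abs).bddAbove
    ⟨z, hz, rfl⟩)

/-- Ulam–Hyers–Rassias stability: under (Q1), (Q2), (Q3) and `W₁(1+W₂)γ < 1`, an
`ε ρ`-approximate solution `ω` and an exact solution `ϑ` with the same initial value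
satisfy `|ω(z) - ϑ(z)| ≤ B ε ρ(z)` with `B = γ / (1 - W₁(1+W₂)γ)`. -/
theorem caputo_ulam_hyers_rassias_stability (α b : ℝ) (hα0 : 0 < α) (hα1 : α < 1)
    (hb : 0 < b)
    (ψ ψ' : ℝ → ℝ)
    (hψ_mono : StrictMonoOn ψ (Set.Icc 0 b))
    (hψ_deriv : ∀ z ∈ Set.Icc 0 b, HasDerivWithinAt ψ (ψ' z) (Set.Icc 0 b) z)
    (hψ'_cont : ContinuousOn ψ' (Set.Icc 0 b))
    (hψ'_pos : ∀ z ∈ Set.Icc 0 b, 0 < ψ' z)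
    (F : ℝ → ℝ → ℝ → ℝ) (H : ℝ → ℝ → ℝ → ℝ)
    (hF_cont : ContinuousOn (fun p : ℝ × ℝ × ℝ => F p.1 p.2.1 p.2.2)
      (Set.Icc 0 b ×ˢ (Set.univ : Set ℝ) ×ˢ (Set.univ : Set ℝ)))
    (hH_cont : ContinuousOn (fun p : ℝ × ℝ × ℝ => H p.1 p.2.1 p.2.2)
      (Set.Icc 0 b ×ˢ Set.Icc 0 b ×ˢ (Set.univ : Set ℝ)))
    (n k : ℝ → ℝ)
    (hn_cont : ContinuousOn n (Set.Icc 0 b))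
    (hk_cont : ContinuousOn k (Set.Icc 0 b))
    (hQ1 : ∀ z ∈ Set.Icc 0 b, ∀ u₁ u₂ w₁ w₂ : ℝ,
      |F z u₁ u₂ - F z w₁ w₂| ≤ n z * (|u₁ - w₁| + |u₂ - w₂|))
    (hQ2 : ∀ z ∈ Set.Icc 0 b, ∀ τ ∈ Set.Icc 0 b, ∀ u w : ℝ,
      |H z τ u - H z τ w| ≤ k z * |u - w|)
    (W₁ W₂ : ℝ)
    (hW₁ : W₁ = sSup ((fun z => |n z|) '' Set.Icc 0 b))
    (hW₂ : W₂ = sSup ((fun z => |k z|) '' Set.Icc 0 b))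
    (ρ : ℝ → ℝ)
    (hρ_cont : ContinuousOn ρ (Set.Icc 0 b))
    (hρ_mono : StrictMonoOn ρ (Set.Icc 0 b))
    (hρ_nonneg : ∀ z ∈ Set.Icc 0 b, 0 ≤ ρ z)
    (γ : ℝ) (hγ : 0 < γ)
    (hQ3 : ∀ z ∈ Set.Icc 0 b, psiInt α ψ ψ' ρ z ≤ γ * ρ z)
    (hsmall : W₁ * (1 + W₂) * γ < 1)
    (ε : ℝ) (hε : 0 < ε)
    (ω ω' : ℝ → ℝ)
    (hω_deriv : ∀ z ∈ Set.Icc 0 b, HasDerivWithinAt ω (ω' z) (Set.Icc 0 b) z)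
    (hω'_cont : ContinuousOn ω' (Set.Icc 0 b))
    (hω_approx : ∀ z ∈ Set.Icc 0 b,
      |psiCaputo α ψ ψ' ω' z -
        F z (ω z) (psiInt α ψ ψ' (fun τ => H z τ (psiCaputo α ψ ψ' ω' τ)) z)| ≤ ε * ρ z)
    (v v' : ℝ → ℝ)
    (hv_deriv : ∀ z ∈ Set.Icc 0 b, HasDerivWithinAt v (v' z) (Set.Icc 0 b) z)
    (hv'_cont : ContinuousOn v' (Set.Icc 0 b))
    (hv_sol : ∀ z ∈ Set.Icc 0 b,
      psiCaputo α ψ ψ' v' z =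
        F z (v z) (psiInt α ψ ψ' (fun τ => H z τ (psiCaputo α ψ ψ' v' τ)) z))
    (hv0 : v 0 = ω 0) :
    ∀ z ∈ Set.Icc 0 b,
      |ω z - v z| ≤ γ / (1 - W₁ * (1 + W₂) * γ) * ε * ρ z := by
  have hsup_nonneg : ∀ f : ℝ → ℝ, 0 ≤ sSup ((fun z => |f z|) '' Icc 0 b) := fun f =>
    Real.sSup_nonneg (by rintro _ ⟨t, _, rfl⟩; exact abs_nonneg _)
  obtain ⟨φ, hφ, hφψ⟩ := exists_continuous_eqOn_Icc hb.le
    fun t ht => (hψ_deriv t ht).continuousWithinAt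
  obtain ⟨φ', hφ', hφψ'⟩ := exists_continuous_eqOn_Icc hb.le hψ'_cont
  obtain ⟨ξ, hξ, hξω⟩ := exists_continuous_eqOn_Icc hb.le hω'_cont
  obtain ⟨ζ, hζ, hζv⟩ := exists_continuous_eqOn_Icc hb.le hv'_cont
  have hclock : IsClock b φ φ' :=
    { continuous := hφ
      continuous_deriv := hφ'
      strictMonoOn := hψ_mono.congr hφψ.symm
      hasDerivWithinAt := fun t ht => by
        rw [hφψ' ht]
        exact (hψ_deriv t ht).congr hφψ (hφψ ht)
      deriv_pos := fun t ht => (hφψ' ht).symm ▸ hψ'_pos t ht }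
  have hcap : ∀ {d e : ℝ → ℝ}, EqOn d e (Icc 0 b) →
      EqOn (psiCaputo α φ φ' d) (psiCaputo α ψ ψ' e) (Icc 0 b) := fun hde z hz =>
    psiCaputo_congr hφψ hφψ' hde hz
  have hmem : ∀ {d e : ℝ → ℝ}, EqOn d e (Icc 0 b) → ∀ z ∈ Icc 0 b,
      psiInt α φ φ' (fun τ => H z τ (psiCaputo α φ φ' d τ)) z =
        psiInt α ψ ψ' (fun τ => H z τ (psiCaputo α ψ ψ' e τ)) z := fun hde z hz =>
    psiInt_congr hφψ hφψ' (fun τ hτ => congrArg (H z τ) (hcap hde hτ)) hz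
  intro z hz
  refine hclock.ulam_hyers_rassias hα0 hα1 hb.le (F := F) hH_cont (hW₁ ▸ hsup_nonneg n)
    (hW₂ ▸ hsup_nonneg k)
    (fun t ht u₁ u₂ w₁ w₂ => (hQ1 t ht u₁ u₂ w₁ w₂).trans (mul_le_mul_of_nonneg_right
      (hW₁ ▸ le_sSup_abs_image hn_cont t ht) (by positivity)))
    (fun t ht τ hτ u w => (hQ2 t ht τ hτ u w).trans (mul_le_mul_of_nonneg_right
      (hW₂ ▸ le_sSup_abs_image hk_cont t ht) (abs_nonneg _)))
    hρ_cont hρ_nonneg hγ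
    (fun t ht => (psiInt_congr hφψ hφψ' (fun _ _ => rfl) ht).trans_le (hQ3 t ht))
    hsmall hε hξ hζ (fun t ht => hξω ht ▸ hω_deriv t ht) (fun t ht => hζv ht ▸ hv_deriv t ht)
    (fun t ht => ?_) (fun t ht => ?_) hv0 hz
  · rw [hcap hξω ht, hmem hξω t ht]
    exact hω_approx t ht
  · rw [hcap hζv ht, hmem hζv t ht]
    exact hv_sol t ht
end
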